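/- arXiv:1005.3634 — 3 statements merged into one kernel-verified Lean document; each statement's English description precedes it below -/
import Mathlib

section
/- Let X be a complex Banach space, S : X → X a strictly singular bounded linear operator, and λ ∈ ℂ. Then the operator λI + S does not satisfy the Strong Distributional Chaos Criterion for any constant r > 1. -/
open Filter Topology
open scoped ENNReal

section Defs

variable {𝕜 : Type*} [RCLike 𝕜] {X : Type*} [NormedAddCommGroup X] [NormedSpace 𝕜 X]

/-- The upper density of a set of natural numbers. -/
noncomputable def upperDensity (A : Set ℕ) : ℝ :=
  Filter.limsup (fun n : ℕ => ((A ∩ Set.Icc 1 n).ncard : ℝ) / n) Filter.atTop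

/-- The lower density of a set of natural numbers. -/
noncomputable def lowerDensity (A : Set ℕ) : ℝ :=
  Filter.liminf (fun n : ℕ => ((A ∩ Set.Icc 1 n).ncard : ℝ) / n) Filter.atTop

/-- `{x, y}` is a Li-Yorke pair for `T`. -/
def IsLiYorkePair (T : X →L[𝕜] X) (x y : X) : Prop :=
  Filter.liminf (fun n : ℕ => (‖(T ^ n) x - (T ^ n) y‖₊ : ℝ≥0∞)) Filter.atTop = 0 ∧
  0 < Filter.limsup (fun n : ℕ => (‖(T ^ n) x - (T ^ n) y‖₊ : ℝ≥0∞)) Filter.atTop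

/-- `T` is Li-Yorke chaotic. -/
def LiYorkeChaotic (T : X →L[𝕜] X) : Prop :=
  ∃ Γ : Set X, ¬ Γ.Countable ∧ ∀ x ∈ Γ, ∀ y ∈ Γ, x ≠ y → IsLiYorkePair T x y

/-- `x` is an irregular vector for `T`. -/
def IrregularVector (T : X →L[𝕜] X) (x : X) : Prop :=
  Filter.liminf (fun n : ℕ => (‖(T ^ n) x‖₊ : ℝ≥0∞)) Filter.atTop = 0 ∧
  Filter.limsup (fun n : ℕ => (‖(T ^ n) x‖₊ : ℝ≥0∞)) Filter.atTop = ⊤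

/-- `x` is a distributionally irregular vector for `T`. -/
def DistIrregularVector (T : X →L[𝕜] X) (x : X) : Prop :=
  ∃ a b : ℕ → ℕ, StrictMono a ∧ StrictMono b ∧ (∀ k, 0 < a k) ∧ (∀ k, 0 < b k) ∧
    upperDensity (Set.range a) = 1 ∧ upperDensity (Set.range b) = 1 ∧
    Filter.Tendsto (fun k => ‖(T ^ (a k)) x‖) Filter.atTop (nhds 0) ∧
    Filter.Tendsto (fun k => ‖(T ^ (b k)) x‖) Filter.atTop Filter.atTop

/-- `Γ` is a distributionally `ε`-scrambled set for `T`. -/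
def DistScrambled (T : X →L[𝕜] X) (Γ : Set X) (ε : ℝ) : Prop :=
  ∀ x ∈ Γ, ∀ y ∈ Γ, x ≠ y →
    lowerDensity {n : ℕ | ‖(T ^ n) x - (T ^ n) y‖ < ε} = 0 ∧
    ∀ τ > (0:ℝ), upperDensity {n : ℕ | ‖(T ^ n) x - (T ^ n) y‖ < τ} = 1

/-- `T` is distributionally chaotic. -/
def DistChaotic (T : X →L[𝕜] X) : Prop :=
  ∃ Γ : Set X, ∃ ε > (0:ℝ), ¬ Γ.Countable ∧ DistScrambled T Γ ε

/-- The Li-Yorke Chaos Criterion. -/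
def LYChaosCriterion (T : X →L[𝕜] X) : Prop :=
  ∃ n : ℕ → ℕ, ∃ X₀ : Set X, StrictMono n ∧ (∀ k, 0 < n k) ∧
    (∀ x ∈ X₀, Filter.Tendsto (fun k : ℕ => (T ^ (n k)) x) Filter.atTop (nhds 0)) ∧
    ∀ C : ℝ, ∃ m : ℕ, ∃ y ∈ closure ((Submodule.span 𝕜 X₀ : Submodule 𝕜 X) : Set X),
      C * ‖y‖ < ‖(T ^ m) y‖

/-- The Strong Distributional Chaos Criterion with constant `r`. -/
def SDCCriterion (T : X →L[𝕜] X) (r : ℝ) : Prop :=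
  ∀ m : ℕ, ∃ x : X, x ≠ 0 ∧
    Filter.Tendsto (fun k : ℕ => ‖(T ^ k) x‖) Filter.atTop (nhds 0) ∧
    ∀ i : ℕ, 1 ≤ i → i ≤ m → r ^ i * ‖x‖ ≤ ‖(T ^ i) x‖

/-- The Distributional Chaos Criterion. -/
def DCCriterion (T : X →L[𝕜] X) : Prop :=
  ∃ x y : ℕ → X, ∃ N : ℕ → ℕ,
    (∀ m, x m ≠ 0) ∧ (∀ m, y m ≠ 0) ∧
    (∀ m, y m ∈ closure ((Submodule.span 𝕜 (Set.range x) : Submodule 𝕜 X) : Set X)) ∧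
    (∀ m, Filter.Tendsto (fun n : ℕ => (T ^ n) (x m)) Filter.atTop (nhds 0)) ∧
    (∀ m, 0 < N m) ∧ Monotone N ∧ Filter.Tendsto N Filter.atTop Filter.atTop ∧
    Filter.Tendsto
      (fun m : ℕ =>
        (({i : ℕ | i < N m ∧ (m : ℝ) * ‖y m‖ ≤ ‖(T ^ i) (y m)‖}).ncard : ℝ) / N m)
      Filter.atTop (nhds 1)

/-- `T` admits a dense irregular manifold. -/
def DenseIrregularManifold (T : X →L[𝕜] X) : Prop :=
  ∃ Y : Submodule 𝕜 X, Dense (Y : Set X) ∧ ∀ y ∈ Y, y ≠ 0 → IrregularVector T y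

/-- `T` admits a dense distributionally irregular manifold. -/
def DenseDistIrregularManifold (T : X →L[𝕜] X) : Prop :=
  ∃ Y : Submodule 𝕜 X, Dense (Y : Set X) ∧ ∀ y ∈ Y, y ≠ 0 → DistIrregularVector T y


/-- `S` is strictly singular: it is not bounded below on any infinite-dimensional subspace. -/
def StrictlySingular (S : X →L[𝕜] X) : Prop :=
  ∀ M : Submodule 𝕜 X, ¬ FiniteDimensional 𝕜 M →
    ¬ ∃ c : ℝ, 0 < c ∧ ∀ x ∈ M, c * ‖x‖ ≤ ‖S x‖

end Defs

section Helpers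

open Metric Set

variable {E : Type*} [NormedAddCommGroup E] [NormedSpace ℂ E]

/-- Coefficients of a combination of a triangular system of vectors and norming functionals
grow at most geometrically. -/
theorem norm_coeff_le_of_triangular {v : ℕ → E} {f : ℕ → E →L[ℂ] ℂ}
    (hv : ∀ n, ‖v n‖ ≤ 1) (hf : ∀ n, ‖f n‖ ≤ 1) (hfv : ∀ n, f n (v n) = 1)
    (h0 : ∀ m n, m < n → f m (v n) = 0) (c : ℕ → ℂ) (n : ℕ) :
    ∀ j < n, ‖c j‖ ≤ 2 ^ j * ‖∑ i ∈ Finset.range n, c i • v i‖ := by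
  set x := ∑ i ∈ Finset.range n, c i • v i with hx
  intro j
  induction j using Nat.strong_induction_on with
  | _ j ih =>
    intro hj
    have hsplit : f j x = (∑ i ∈ Finset.range j, c i * f j (v i)) + c j := by
      have h1 : f j x = ∑ i ∈ Finset.range n, c i * f j (v i) := by simp [hx]
      rw [h1, ← Finset.sum_subset (Finset.range_subset_range.2 (Nat.succ_le_of_lt hj)),
        Finset.sum_range_succ, hfv, mul_one]
      intro i _ hi
      rw [h0 j i (by simpa using hi), mul_zero]
    have hfx : ‖f j x‖ ≤ ‖x‖ := by
      simpa using (f j).le_of_opNorm_le (hf j) x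
    have hsum : ‖∑ i ∈ Finset.range j, c i * f j (v i)‖
        ≤ ∑ i ∈ Finset.range j, 2 ^ i * ‖x‖ := by
      refine norm_sum_le_of_le _ fun i hi => ?_
      have hi' := Finset.mem_range.1 hi
      have h2 : ‖f j (v i)‖ ≤ 1 := by
        have := (f j).le_of_opNorm_le (hf j) (v i)
        linarith [hv i]
      rw [norm_mul]
      calc ‖c i‖ * ‖f j (v i)‖ ≤ ‖c i‖ * 1 := by gcongr
        _ ≤ 2 ^ i * ‖x‖ := by rw [mul_one]; exact ih i hi' (hi'.trans hj)
    have hgeom : ∑ i ∈ Finset.range j, (2 : ℝ) ^ i * ‖x‖ = (2 ^ j - 1) * ‖x‖ := by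
      rw [← Finset.sum_mul, geom_sum_eq (by norm_num)]
      norm_num
    have hc : c j = f j x - ∑ i ∈ Finset.range j, c i * f j (v i) := by rw [hsplit]; ring
    rw [hc]
    refine (norm_sub_le _ _).trans ?_
    rw [hgeom] at hsum
    linarith

/-- If `A` is bounded below on no closed subspace of finite codimension, then it is arbitrarily
small on some infinite-dimensional subspace. -/
theorem exists_infiniteDimensional_norm_le (A : E →L[ℂ] E)
    (h : ∀ N : Submodule ℂ E, IsClosed (N : Set E) → N.CoFG →
      ∀ ε > (0 : ℝ), ∃ x ∈ N, ‖A x‖ < ε * ‖x‖) {δ : ℝ} (hδ : 0 < δ) :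
    ∃ M : Submodule ℂ E, ¬ FiniteDimensional ℂ M ∧ ∀ x ∈ M, ‖A x‖ ≤ δ * ‖x‖ := by
  obtain ⟨s, hs, hr⟩ := exists_seq_of_forall_finset_exists
    (fun p : E × (E →L[ℂ] ℂ) × ℝ => ‖p.1‖ ≤ 1 ∧ ‖p.2.1‖ ≤ 1 ∧ p.2.1 p.1 = 1 ∧
      0 < p.2.2 ∧ p.2.2 ≤ δ / 2 ∧ ‖A p.1‖ ≤ p.2.2)
    (fun p q => p.2.1 q.1 = 0 ∧ q.2.2 ≤ p.2.2 / 4) (by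
      intro s hs
      obtain ⟨ε, hε, hεδ, hεs⟩ : ∃ ε : ℝ, 0 < ε ∧ ε ≤ δ / 2 ∧ ∀ p ∈ s, ε ≤ p.2.2 / 4 := by
        have hev : ∀ᶠ ε : ℝ in 𝓝[>] 0, 0 < ε ∧ ε ≤ δ / 2 ∧ ∀ p ∈ s, ε ≤ p.2.2 / 4 := by
          refine eventually_mem_nhdsWithin.and (Eventually.and ?_ ?_)
          · exact nhdsWithin_le_nhds (eventually_le_nhds (by positivity))
          · rw [eventually_all_finset]
            intro p hp
            have := (hs p hp).2.2.2.1
            exact nhdsWithin_le_nhds (eventually_le_nhds (by positivity))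
        exact hev.exists
      let N : Submodule ℂ E := sInf ((s.image fun p => LinearMap.ker p.2.1.toLinearMap :
        Finset (Submodule ℂ E)) : Set (Submodule ℂ E))
      have hmem : ∀ x ∈ N, ∀ p ∈ s, p.2.1 x = 0 := by
        intro x hx p hp
        have := (Submodule.mem_sInf.1 hx) (LinearMap.ker p.2.1.toLinearMap)
          (Finset.mem_coe.2 (Finset.mem_image_of_mem _ hp))
        simpa using this
      have hNc : IsClosed (N : Set E) := by
        rw [Submodule.coe_sInf]
        refine isClosed_biInter fun K hK => ?_
        obtain ⟨p, -, rfl⟩ := Finset.mem_image.1 (Finset.mem_coe.1 hK)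
        exact p.2.1.isClosed_ker
      have hNf : N.CoFG := by
        refine Submodule.CoFG.sInf fun K hK => ?_
        obtain ⟨p, -, rfl⟩ := Finset.mem_image.1 hK
        exact Submodule.CoFG.ker _
      obtain ⟨x, hxN, hx⟩ := h N hNc hNf ε hε
      have hx0 : ‖x‖ ≠ 0 := by
        intro h0
        rw [h0, mul_zero] at hx
        exact absurd hx (not_lt.2 (norm_nonneg _))
      obtain ⟨g, hg, hgx⟩ := exists_dual_vector ℂ x hx0
      have hx0' : (‖x‖ : ℂ) ≠ 0 := by exact_mod_cast hx0
      refine ⟨((‖x‖ : ℂ)⁻¹ • x, g, ε), ⟨?_, hg.le, ?_, hε, hεδ, ?_⟩, fun p hp => ⟨?_, hεs p hp⟩⟩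
      · simp [norm_smul, hx0]
      · have hgx' : g x = (‖x‖ : ℂ) := hgx
        simp [hgx', hx0']
      · have : 0 < ‖x‖ := lt_of_le_of_ne (norm_nonneg _) (Ne.symm hx0)
        simp only [map_smul, norm_smul, norm_inv, Complex.norm_real, norm_norm]
        rw [inv_mul_le_iff₀ this, mul_comm]
        exact hx.le
      · simp [hmem x hxN p hp])
  have hε : ∀ n, (s n).2.2 ≤ δ / 2 * (1 / 4) ^ n := by
    intro n
    induction n with
    | zero => simpa using (hs 0).2.2.2.2.1
    | succ n ih =>
      have := (hr n (n + 1) n.lt_succ_self).2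
      rw [pow_succ]
      linarith
  have hcoef := norm_coeff_le_of_triangular (fun n => (hs n).1) (fun n => (hs n).2.1)
    (fun n => (hs n).2.2.1) (fun m n hmn => (hr m n hmn).1)
  have hli : LinearIndependent ℂ fun n => (s n).1 := by
    rw [linearIndependent_iff']
    intro t c hc i hi
    obtain ⟨n, hn⟩ := t.exists_nat_subset_range
    have hsum : ∑ j ∈ Finset.range n, (if j ∈ t then c j else 0) • (s j).1 = 0 := by
      rw [← hc, ← Finset.sum_subset hn]
      · exact Finset.sum_congr rfl fun j hj => by rw [if_pos hj]
      · intro j _ hj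
        rw [if_neg hj, zero_smul]
    have := hcoef (fun j => if j ∈ t then c j else 0) n i (Finset.mem_range.1 (hn hi))
    rw [hsum] at this
    simpa [hi] using this
  refine ⟨Submodule.span ℂ (range fun n => (s n).1), fun hfin => ?_, fun x hx => ?_⟩
  · exact not_finite_iff_infinite.2 inferInstance (Module.Finite.finite_basis (Module.Basis.span hli))
  · obtain ⟨c, rfl⟩ := Finsupp.mem_span_range_iff_exists_finsupp.1 hx
    obtain ⟨n, hn⟩ := c.support.exists_nat_subset_range
    rw [Finsupp.sum_of_support_subset c hn _ (by simp)]
    set x := ∑ i ∈ Finset.range n, c i • (s i).1 with hxdef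
    have hterm : ∀ j ∈ Finset.range n, ‖A (c j • (s j).1)‖ ≤ δ / 2 * ‖x‖ * (1 / 2) ^ j := by
      intro j hj
      rw [map_smul, norm_smul]
      calc ‖c j‖ * ‖A (s j).1‖ ≤ (2 ^ j * ‖x‖) * (δ / 2 * (1 / 4) ^ j) :=
            mul_le_mul (hcoef c n j (Finset.mem_range.1 hj))
              ((hs j).2.2.2.2.2.trans (hε j)) (norm_nonneg _) (by positivity)
        _ = δ / 2 * ‖x‖ * (2 * (1 / 4)) ^ j := by rw [mul_pow]; ring
        _ = _ := by norm_num
    calc ‖A x‖ ≤ ∑ j ∈ Finset.range n, δ / 2 * ‖x‖ * (1 / 2) ^ j := by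
          rw [hxdef, map_sum]
          exact norm_sum_le_of_le _ hterm
      _ ≤ δ / 2 * ‖x‖ * 2 := by
          rw [← Finset.mul_sum]
          gcongr
          exact sum_geometric_two_le n
      _ = δ * ‖x‖ := by ring

/-- A nonzero scalar perturbation of a strictly singular operator is bounded below on a closed
subspace of finite codimension. -/
theorem StrictlySingular.exists_boundedBelow {S : E →L[ℂ] E} (hS : StrictlySingular S) {μ : ℂ}
    (hμ : μ ≠ 0) {A : E →L[ℂ] E} (hA : ∀ x, A x = S x - μ • x) :
    ∃ N : Submodule ℂ E, IsClosed (N : Set E) ∧ N.CoFG ∧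
      ∃ ε > (0 : ℝ), ∀ x ∈ N, ε * ‖x‖ ≤ ‖A x‖ := by
  by_contra! hcon
  have hμ' : 0 < ‖μ‖ := norm_pos_iff.2 hμ
  obtain ⟨M, hM, hle⟩ := exists_infiniteDimensional_norm_le A hcon (half_pos hμ')
  refine hS M hM ⟨‖μ‖ / 2, half_pos hμ', fun x hx => ?_⟩
  have h1 : ‖μ • x‖ ≤ ‖S x‖ + ‖A x‖ := by
    have : μ • x = S x - A x := by rw [hA]; abel
    rw [this]
    exact norm_sub_le _ _
  rw [norm_smul] at h1
  linarith [hle x hx]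

theorem StrictlySingular.isClosed_range [CompleteSpace E] {S : E →L[ℂ] E}
    (hS : StrictlySingular S) {μ : ℂ} (hμ : μ ≠ 0) {A : E →L[ℂ] E}
    (hA : ∀ x, A x = S x - μ • x) : IsClosed (range A) := by
  obtain ⟨N, hNc, hNf, ε, hε, hN⟩ := hS.exists_boundedBelow hμ hA
  have : CompleteSpace N := hNc.completeSpace_coe
  have hanti : AntilipschitzWith (Real.toNNReal ε⁻¹) (A.comp N.subtypeL) := by
    refine ContinuousLinearMap.antilipschitz_of_bound _ fun x => ?_
    rw [Real.coe_toNNReal _ (by positivity), inv_mul_eq_div, le_div_iff₀ hε, mul_comm]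
    exact hN x x.2
  have hcl := hanti.isClosed_range (A.comp N.subtypeL).uniformContinuous
  have := LinearMap.isClosed_range_of_isClosed_map_of_finiteDimensional_quotient
    (f := A.toLinearMap) (s := N) (by
      convert hcl using 1
      ext y
      simp)
  rwa [LinearMap.coe_range] at this

/-- Near a surjective, non-injective operator all operators are non-injective. -/
theorem eventually_not_injective [CompleteSpace E] {A : E →L[ℂ] E}
    (hsurj : Function.Surjective A) (hinj : ¬ Function.Injective A) :
    ∀ᶠ B : E →L[ℂ] E in 𝓝 A, ¬ Function.Injective B := by
  obtain ⟨k, hk, hk0⟩ : ∃ k, A k = 0 ∧ k ≠ 0 := by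
    by_contra! hcon
    exact hinj ((injective_iff_map_eq_zero A).2 hcon)
  have hrange := LinearMap.range_eq_top.2 hsurj
  set R := A.nonlinearRightInverseOfSurjective hrange
  have hR : 0 < R.nnnorm := A.nonlinearRightInverseOfSurjective_nnnorm_pos hrange
  have hR' : (0 : ℝ) < (R.nnnorm : ℝ)⁻¹ := inv_pos.2 (by exact_mod_cast hR)
  filter_upwards [ball_mem_nhds A (show (0 : ℝ) < (R.nnnorm : ℝ)⁻¹ / 3 by positivity)] with B hB hBinj
  rw [mem_ball, dist_eq_norm] at hB
  have happ : ApproximatesLinearOn B A univ ‖B - A‖₊ := by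
    intro x _ y _
    simpa using (B - A).le_opNorm (x - y)
  have hk' : 0 < ‖k‖ := norm_pos_iff.2 hk0
  have hs := happ.surjOn_closedBall_of_nonlinearRightInverse R (ε := ‖k‖ / 2) (b := 0)
    (by positivity) (subset_univ _)
  obtain ⟨y, hy, hyk⟩ := hs (show B k ∈ _ by
    rw [mem_closedBall, map_zero, dist_zero_right]
    have h1 : B k = (B - A) k := by simp [hk]
    rw [h1]
    refine ((B - A).le_opNorm k).trans ?_
    rw [coe_nnnorm]
    nlinarith)
  rw [hBinj hyk, mem_closedBall, dist_zero_right] at hy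
  linarith

/-- The generating function `∑ w ^ n T ^ n x` of an orbit. -/
noncomputable def orbitSeries (T : E →L[ℂ] E) (x : E) : FormalMultilinearSeries ℂ ℂ E :=
  fun n => ContinuousMultilinearMap.mkPiRing ℂ (Fin n) ((T ^ n) x)

theorem one_le_radius_orbitSeries {T : E →L[ℂ] E} {x : E}
    (hx : Tendsto (fun k : ℕ => ‖(T ^ k) x‖) atTop (𝓝 0)) : 1 ≤ (orbitSeries T x).radius := by
  obtain ⟨C, hC⟩ := hx.bddAbove_range
  refine (orbitSeries T x).le_radius_of_bound (r := 1) C fun n => ?_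
  simpa [orbitSeries] using hC (mem_range_self n)

theorem hasFPowerSeriesOnBall_orbitSeries [CompleteSpace E] {T : E →L[ℂ] E} {x : E}
    (hx : Tendsto (fun k : ℕ => ‖(T ^ k) x‖) atTop (𝓝 0)) :
    HasFPowerSeriesOnBall (orbitSeries T x).sum (orbitSeries T x) 0 1 :=
  ((orbitSeries T x).hasFPowerSeriesOnBall
    (zero_lt_one.trans_le (one_le_radius_orbitSeries hx))).mono zero_lt_one
    (one_le_radius_orbitSeries hx)

theorem orbitSeries_sum_sub [CompleteSpace E] {T : E →L[ℂ] E} {x : E}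
    (hx : Tendsto (fun k : ℕ => ‖(T ^ k) x‖) atTop (𝓝 0)) {w : ℂ} (hw : ‖w‖ < 1) :
    (orbitSeries T x).sum w - w • T ((orbitSeries T x).sum w) = x := by
  have hsum : HasSum (fun n : ℕ => w ^ n • (T ^ n) x) ((orbitSeries T x).sum w) := by
    have := (hasFPowerSeriesOnBall_orbitSeries hx).hasSum (y := w) (by
      rw [mem_eball, edist_zero_right]
      simpa [enorm_eq_nnnorm, ← NNReal.coe_lt_coe] using hw)
    simpa [orbitSeries] using this
  have hshift : HasSum (fun n : ℕ => w ^ (n + 1) • (T ^ (n + 1)) x)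
      (w • T ((orbitSeries T x).sum w)) := by
    convert (T.hasSum hsum).const_smul w using 2 with n
    rw [map_smul, smul_smul, pow_succ', pow_succ']
    rfl
  have h0 := (hasSum_nat_add_iff' (f := fun n : ℕ => w ^ n • (T ^ n) x) 1).2 hsum
  rw [hshift.unique h0]
  simp

theorem norm_pow_apply_le_of_orbitSeries [CompleteSpace E] {T : E →L[ℂ] E} {x : E}
    (hx : Tendsto (fun k : ℕ => ‖(T ^ k) x‖) atTop (𝓝 0)) {ρ C : ℝ} (hρ : 0 < ρ) (hρ1 : ρ < 1)
    (hC : ∀ w ∈ sphere (0 : ℂ) ρ, ‖(orbitSeries T x).sum w‖ ≤ C) (n : ℕ) :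
    ‖(T ^ n) x‖ ≤ C / ρ ^ n := by
  have hp := hasFPowerSeriesOnBall_orbitSeries hx
  have hd : DifferentiableOn ℂ (orbitSeries T x).sum (closedBall 0 ρ) := by
    refine hp.differentiableOn.mono fun w hw => ?_
    rw [mem_eball, edist_zero_right]
    have : ‖w‖ < 1 := (mem_closedBall_zero_iff.1 hw).trans_lt hρ1
    simpa [enorm_eq_nnnorm, ← NNReal.coe_lt_coe] using this
  have hder := Complex.norm_iteratedDeriv_le_of_forall_mem_sphere_norm_le n hρ
    (hd.diffContOnCl_ball subset_rfl) hC
  have hfac := hp.factorial_smul 1 n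
  rw [← iteratedDeriv_eq_iteratedFDeriv] at hfac
  rw [← hfac] at hder
  have hn : (0 : ℝ) < n.factorial := by exact_mod_cast n.factorial_pos
  have h2 : ‖n.factorial • (orbitSeries T x n) fun _ => (1 : ℂ)‖ = n.factorial * ‖(T ^ n) x‖ := by
    rw [← Nat.cast_smul_eq_nsmul ℂ, norm_smul]
    simp [orbitSeries]
  rw [h2, mul_div_assoc] at hder
  exact le_of_mul_le_mul_left hder hn

/-- If vectors with null orbits are dense, then for `‖z‖ > 1`, `z ≠ λ` the operator
`λ + S - z` is surjective. -/
theorem surjective_of_dense_null_orbits [CompleteSpace E] {S T : E →L[ℂ] E}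
    (hS : StrictlySingular S) {lam : ℂ} (hT : ∀ x, T x = lam • x + S x)
    (hd : Dense {x : E | Tendsto (fun k : ℕ => ‖(T ^ k) x‖) atTop (𝓝 0)})
    {z : ℂ} (hz : 1 < ‖z‖) (hzl : z ≠ lam) :
    Function.Surjective (algebraMap ℂ (E →L[ℂ] E) z - T) := by
  have hz0 : z ≠ 0 := norm_pos_iff.1 (zero_lt_one.trans hz)
  have hcl : IsClosed (range (algebraMap ℂ (E →L[ℂ] E) z - T)) := by
    have h1 := hS.isClosed_range (sub_ne_zero.2 hzl) (A := T - algebraMap ℂ (E →L[ℂ] E) z) (by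
      intro x
      simp [Algebra.algebraMap_eq_smul_one, hT, sub_smul]
      abel)
    convert h1 using 1
    ext y
    constructor <;> rintro ⟨x, rfl⟩ <;>
      exact ⟨-x, by simp only [map_neg, sub_apply]; abel⟩
  rw [← range_eq_univ, ← hcl.closure_eq]
  refine (hd.mono fun x hx => ?_).closure_eq
  have hw : ‖z⁻¹‖ < 1 := by rw [norm_inv]; exact inv_lt_one_of_one_lt₀ hz
  refine ⟨z⁻¹ • (orbitSeries T x).sum z⁻¹, ?_⟩
  conv_rhs => rw [← orbitSeries_sum_sub hx hw]
  simp [Algebra.algebraMap_eq_smul_one, smul_sub, smul_smul, hz0]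

/-- If vectors with null orbits are dense, every circle of radius `s > 1`, `s ≠ |λ|` lies in the
resolvent set of `λ + S`. -/
theorem sphere_subset_resolventSet [CompleteSpace E] {S T : E →L[ℂ] E}
    (hS : StrictlySingular S) {lam : ℂ} (hT : ∀ x, T x = lam • x + S x)
    (hd : Dense {x : E | Tendsto (fun k : ℕ => ‖(T ^ k) x‖) atTop (𝓝 0)})
    {s : ℝ} (hs : 1 < s) (hsl : s ≠ ‖lam‖) :
    sphere (0 : ℂ) s ⊆ resolventSet ℂ T := by
  obtain ⟨u, hu, hul⟩ : ∃ u : ℂ, ‖u‖ = 1 ∧ ∀ t : ℝ, 1 < t → (t : ℂ) * u ≠ lam := by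
    rcases le_total 0 lam.re with h | h
    · refine ⟨-1, by simp, fun t ht heq => ?_⟩
      rw [← heq] at h
      simp at h
      linarith
    · refine ⟨1, by simp, fun t ht heq => ?_⟩
      rw [← heq] at h
      simp at h
      linarith
  set ray : Set ℂ := (fun t : ℝ => (t : ℂ) * u) '' Ioi 1
  have hray : IsPreconnected ray := isPreconnected_Ioi.image _ (by fun_prop)
  have hconn : IsPreconnected (sphere (0 : ℂ) s ∪ ray) := by
    refine IsPreconnected.union (s * u) ?_ ⟨s, hs, rfl⟩
      (isPreconnected_sphere (by simp [Complex.rank_real_complex]) 0 s) hray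
    simp [hu, abs_of_pos (zero_lt_one.trans hs)]
  set V : Set ℂ := {z | 1 < ‖z‖ ∧ z ≠ lam ∧
    ¬ Function.Injective (algebraMap ℂ (E →L[ℂ] E) z - T)}
  have hV : IsOpen V := by
    rw [isOpen_iff_mem_nhds]
    rintro z ⟨hz, hzl, hinj⟩
    have hcont : Continuous fun z : ℂ => algebraMap ℂ (E →L[ℂ] E) z - T := by fun_prop
    filter_upwards [(isOpen_lt continuous_const continuous_norm).mem_nhds hz,
      isOpen_ne.mem_nhds hzl, hcont.continuousAt.eventually
        (eventually_not_injective (surjective_of_dense_null_orbits hS hT hd hz hzl) hinj)]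
      with y h1 h2 h3 using ⟨h1, h2, h3⟩
  have hmem : ∀ z : ℂ, z ∈ resolventSet ℂ T ↔
      Function.Bijective (algebraMap ℂ (E →L[ℂ] E) z - T) := fun z => by
    rw [spectrum.mem_resolventSet_iff, ContinuousLinearMap.isUnit_iff_bijective]
  have hdisj : Disjoint (resolventSet ℂ T) V := by
    rw [Set.disjoint_left]
    exact fun z hz hzV => hzV.2.2 ((hmem z).1 hz).1
  refine subset_union_left.trans (hconn.subset_left_of_subset_union
    (spectrum.isOpen_resolventSet T) hV hdisj ?_ ?_)
  · intro z hz
    have hz' : 1 < ‖z‖ ∧ z ≠ lam := by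
      rcases hz with hz | ⟨t, ht, rfl⟩
      · rw [mem_sphere_zero_iff_norm] at hz
        exact ⟨hz ▸ hs, fun h => hsl (by rw [← hz, h])⟩
      · refine ⟨?_, hul t ht⟩
        simpa [hu] using ht.trans_le (le_abs_self t)
    by_cases hinj : Function.Injective (algebraMap ℂ (E →L[ℂ] E) z - T)
    · exact Or.inl ((hmem z).2 ⟨hinj, surjective_of_dense_null_orbits hS hT hd hz'.1 hz'.2⟩)
    · exact Or.inr ⟨hz'.1, hz'.2, hinj⟩
  · set t : ℝ := ‖T‖ * ‖(1 : E →L[ℂ] E)‖ + 2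
    have ht : 0 ≤ ‖T‖ * ‖(1 : E →L[ℂ] E)‖ := by positivity
    have ht1 : 1 < t := by simp only [t]; linarith
    refine ⟨t * u, Or.inr ⟨t, ht1, rfl⟩, spectrum.mem_resolventSet_of_norm_lt_mul ?_⟩
    rw [norm_mul, hu, mul_one, Complex.norm_real, Real.norm_of_nonneg (by linarith)]
    simp only [t]
    linarith

/-- If vectors with null orbits are dense, their orbits under `λ + S` grow uniformly slower than
`s ^ k`. -/
theorem exists_norm_pow_apply_le [CompleteSpace E] {S T : E →L[ℂ] E}
    (hS : StrictlySingular S) {lam : ℂ} (hT : ∀ x, T x = lam • x + S x)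
    (hd : Dense {x : E | Tendsto (fun k : ℕ => ‖(T ^ k) x‖) atTop (𝓝 0)})
    {s : ℝ} (hs : 1 < s) (hsl : s ≠ ‖lam‖) :
    ∃ C : ℝ, ∀ x, Tendsto (fun k : ℕ => ‖(T ^ k) x‖) atTop (𝓝 0) →
      ∀ n, ‖(T ^ n) x‖ ≤ C * ‖x‖ * s ^ n := by
  have hs0 : 0 < s := zero_lt_one.trans hs
  have hres := sphere_subset_resolventSet hS hT hd hs hsl
  obtain ⟨M, hM⟩ := (isCompact_sphere (0 : ℂ) s).exists_bound_of_continuousOn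
    (f := resolvent T)
    fun z hz => (spectrum.hasDerivAt_resolvent_const_left (hres hz)).continuousAt.continuousWithinAt
  refine ⟨s * M, fun x hx n => ?_⟩
  have hbound := norm_pow_apply_le_of_orbitSeries hx (ρ := s⁻¹) (C := s * M * ‖x‖)
    (inv_pos.2 hs0) (inv_lt_one_of_one_lt₀ hs) (fun w hw => by
      have hwn : ‖w‖ = s⁻¹ := mem_sphere_zero_iff_norm.1 hw
      have hw0 : w ≠ 0 := norm_pos_iff.1 (by rw [hwn]; exact inv_pos.2 hs0)
      have hw' : w⁻¹ ∈ sphere (0 : ℂ) s := by simp [hwn]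
      have hEq := orbitSeries_sum_sub hx (w := w) (by rw [hwn]; exact inv_lt_one_of_one_lt₀ hs)
      set g := (orbitSeries T x).sum w
      have hu : IsUnit (algebraMap ℂ (E →L[ℂ] E) w⁻¹ - T) := hres hw'
      have h1 : (algebraMap ℂ (E →L[ℂ] E) w⁻¹ - T) (w • g) = x := by
        conv_rhs => rw [← hEq]
        simp [Algebra.algebraMap_eq_smul_one, smul_sub, smul_smul, hw0]
      have h2 : resolvent T w⁻¹ x = w • g := by
        rw [← h1]
        exact DFunLike.congr_fun (Ring.inverse_mul_cancel _ hu) (w • g)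
      have h3 : ‖w • g‖ ≤ M * ‖x‖ := by
        rw [← h2]
        exact (resolvent T w⁻¹).le_of_opNorm_le (hM _ hw') x
      rw [norm_smul, hwn, inv_mul_le_iff₀ hs0] at h3
      linarith) n
  rwa [inv_pow, div_inv_eq_mul] at hbound

end Helpers

/-- If `S` is strictly singular, then `λI + S` does not satisfy the SDCC for any `r > 1`. -/
theorem strictlySingular_perturbation_not_SDCC
    {X : Type*} [NormedAddCommGroup X] [NormedSpace ℂ X] [CompleteSpace X]
    (S : X →L[ℂ] X) (hS : StrictlySingular S) (lam : ℂ) :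
    ∀ r : ℝ, 1 < r → ¬ SDCCriterion (lam • ContinuousLinearMap.id ℂ X + S) r := by
  intro r hr hT
  set T := lam • ContinuousLinearMap.id ℂ X + S with hTdef
  obtain ⟨s, ⟨hs1, hsr⟩, hsl⟩ : ∃ s ∈ Set.Ioo 1 r, s ≠ ‖lam‖ :=
    (Set.Ioo_infinite hr).exists_notMem_finite (Set.finite_singleton ‖lam‖)
  let X₀ : Submodule ℂ X :=
    { carrier := {x | Tendsto (fun k : ℕ => (T ^ k) x) atTop (𝓝 0)}
      add_mem' := fun ha hb => by simpa using Tendsto.add ha hb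
      zero_mem' := by simp
      smul_mem' := fun c x hx => by
        simpa only [Set.mem_ofPred_eq, map_smul, smul_zero] using Tendsto.const_smul hx c }
  have hX₀ : ∀ x ∈ X₀, T x ∈ X₀ := fun x hx => by
    have := (tendsto_add_atTop_iff_nat 1).2 (show Tendsto (fun k : ℕ => (T ^ k) x) atTop (𝓝 0) from hx)
    exact this
  let Y := X₀.topologicalClosure
  have hYT : ∀ x ∈ Y, T x ∈ Y := fun x hx =>
    map_mem_closure T.continuous hx hX₀
  have hYS : ∀ x ∈ Y, S x ∈ Y := fun x hx => by
    have : S x = T x - lam • x := by simp [hTdef]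
    rw [this]
    exact Y.sub_mem (hYT x hx) (Y.smul_mem _ hx)
  have hYc : CompleteSpace Y := X₀.isClosed_topologicalClosure.completeSpace_coe
  let TY : Y →L[ℂ] Y := T.restrict hYT
  let SY : Y →L[ℂ] Y := S.restrict hYS
  have hpow : ∀ (k : ℕ) (y : Y), (((TY ^ k) y : Y) : X) = (T ^ k) y := by
    intro k
    induction k with
    | zero => simp
    | succ k ih =>
      intro y
      rw [pow_succ, pow_succ]
      exact ih (TY y)
  have hnorm : ∀ (k : ℕ) (y : Y), ‖(TY ^ k) y‖ = ‖(T ^ k) y‖ := fun k y => by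
    rw [← hpow, Y.coe_norm]
  have hSY : StrictlySingular SY := by
    rintro M hM ⟨c, hc, hcM⟩
    refine hS (M.map Y.subtype) (fun hfin => hM ?_) ⟨c, hc, ?_⟩
    · exact Module.Finite.equiv (M.equivMapOfInjective Y.subtype Y.injective_subtype).symm
    · rintro _ ⟨y, hy, rfl⟩
      exact hcM y hy
  have hdense : Dense {y : Y | Tendsto (fun k : ℕ => ‖(TY ^ k) y‖) atTop (𝓝 0)} := by
    intro y
    rw [closure_subtype]
    refine closure_mono (fun x hx => ?_) y.2
    refine ⟨⟨x, X₀.le_topologicalClosure hx⟩, ?_, rfl⟩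
    simpa only [Set.mem_ofPred_eq, hnorm] using tendsto_zero_iff_norm_tendsto_zero.1 hx
  obtain ⟨C, hC⟩ := exists_norm_pow_apply_le hSY (T := TY) (lam := lam)
    (fun x => Subtype.ext (by simp [TY, SY, hTdef])) hdense hs1 hsl
  have hbound : ∀ m : ℕ, 1 ≤ m → (r / s) ^ m ≤ C := by
    intro m hm
    obtain ⟨x, hx0, hx, hxr⟩ := hT m
    have hxX : x ∈ X₀ := tendsto_zero_iff_norm_tendsto_zero.2 hx
    have h1 := hC ⟨x, X₀.le_topologicalClosure hxX⟩ (by simpa only [hnorm] using hx) m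
    have h2 : ‖(T ^ m) x‖ ≤ C * ‖x‖ * s ^ m := by
      simpa only [hnorm, Y.coe_norm] using h1
    have hxn : 0 < ‖x‖ := norm_pos_iff.2 hx0
    have h3 := (hxr m hm le_rfl).trans h2
    rw [div_pow, div_le_iff₀ (by positivity)]
    refine le_of_mul_le_mul_right (h3.trans_eq ?_) hxn
    ring
  have hrs : 1 < r / s := (one_lt_div (zero_lt_one.trans hs1)).2 hsr
  obtain ⟨m, hm1, hm2⟩ :=
    ((eventually_ge_atTop 1).and
      ((tendsto_pow_atTop_atTop_of_one_lt hrs).eventually_gt_atTop C)).exists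
  exact absurd (hbound m hm1) (not_le.2 hm2)
end

section
/- Let X be a Banach space and T : X → X a bounded linear operator. If T satisfies the Distributional Chaos Criterion, then T admits a distributionally irregular vector. -/
open Filter Topology
open scoped ENNReal

theorem ncard_inter_Icc_le (A : Set ℕ) (n : ℕ) : (A ∩ Set.Icc 1 n).ncard ≤ n := by
  calc (A ∩ Set.Icc 1 n).ncard ≤ (Set.Icc 1 n).ncard :=
        Set.ncard_le_ncard Set.inter_subset_right (Set.finite_Icc 1 n)
    _ = n := by
        rw [← Finset.coe_Icc, Set.ncard_coe_finset]
        simp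

theorem ncard_inter_Icc_mono {A B : Set ℕ} {n : ℕ} (h : ∀ i ∈ Set.Icc 1 n, i ∈ A → i ∈ B) :
    (A ∩ Set.Icc 1 n).ncard ≤ (B ∩ Set.Icc 1 n).ncard :=
  Set.ncard_le_ncard (fun i hi => ⟨h i hi.2 hi.1, hi.2⟩)
    ((Set.finite_Icc 1 n).subset Set.inter_subset_right)

theorem upperDensity_eq_one_of_frequently {A : Set ℕ}
    (h : ∀ k : ℕ, ∃ n > k, (1 - 1 / ((k : ℝ) + 1)) * n ≤ ((A ∩ Set.Icc 1 n).ncard : ℝ)) :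
    upperDensity A = 1 := by
  have hle : ∀ n : ℕ, ((A ∩ Set.Icc 1 n).ncard : ℝ) / n ≤ 1 := fun n =>
    div_le_one_of_le₀ (by exact_mod_cast ncard_inter_Icc_le A n) (Nat.cast_nonneg n)
  have hnonneg : ∀ n : ℕ, 0 ≤ ((A ∩ Set.Icc 1 n).ncard : ℝ) / n := fun n => by positivity
  apply le_antisymm
  · exact limsup_le_of_le (isCoboundedUnder_le_of_le atTop (x := 0) hnonneg)
      (Eventually.of_forall hle)
  · refine le_of_forall_lt fun c hc => ?_
    obtain ⟨c', hcc', hc'⟩ := exists_between hc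
    refine hcc'.trans_le (le_limsup_of_frequently_le ?_ (isBoundedUnder_of ⟨1, hle⟩))
    rw [frequently_atTop]
    intro M
    obtain ⟨K, hK⟩ := exists_nat_one_div_lt (sub_pos.2 hc')
    obtain ⟨n, hn, hcard⟩ := h (max K M)
    refine ⟨n, (le_max_right K M).trans hn.le, ?_⟩
    have hn0 : (0 : ℝ) < n := by exact_mod_cast (Nat.zero_le _).trans_lt hn
    rw [le_div_iff₀ hn0]
    refine le_trans ?_ hcard
    have : 1 / (((max K M : ℕ) : ℝ) + 1) ≤ 1 / ((K : ℝ) + 1) := by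
      apply one_div_le_one_div_of_le (by positivity)
      gcongr
      exact le_max_left K M
    gcongr
    linarith

/-- A decreasing sequence of sets of upper density one has a pseudo-intersection of upper density
one. -/
theorem exists_pseudoIntersection_upperDensity_eq_one {P : ℕ → Set ℕ} (hP : Antitone P)
    (h : ∀ k : ℕ, ∃ n > k, (1 - 1 / ((k : ℝ) + 1)) * n ≤ ((P k ∩ Set.Icc 1 n).ncard : ℝ)) :
    ∃ a : ℕ → ℕ, StrictMono a ∧ (∀ k, 0 < a k) ∧ upperDensity (Set.range a) = 1 ∧
      ∀ k, ∀ᶠ j in atTop, a j ∈ P k := by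
  have hfreq : ∀ k : ℕ, ∃ᶠ n : ℕ in atTop,
      k < n ∧ (1 - 1 / ((k : ℝ) + 1)) * n ≤ ((P k ∩ Set.Icc 1 n).ncard : ℝ) := by
    intro k
    rw [frequently_atTop]
    intro M
    obtain ⟨n, hn, hcard⟩ := h (max k M)
    refine ⟨n, (le_max_right k M).trans hn.le, (le_max_left k M).trans_lt hn, ?_⟩
    calc (1 - 1 / ((k : ℝ) + 1)) * n ≤ (1 - 1 / (((max k M : ℕ) : ℝ) + 1)) * n := by
          gcongr
          exact le_max_left k M
      _ ≤ _ := hcard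
      _ ≤ _ := by
          exact_mod_cast ncard_inter_Icc_mono fun i _ hi => hP (le_max_left k M) hi
  obtain ⟨n, hn, hnP⟩ := extraction_forall_of_frequently hfreq
  set A : Set ℕ := {i | 0 < i ∧ ∀ k, n k < i → i ∈ P k}
  have hdens : ∀ k : ℕ, ∃ N > k,
      (1 - 1 / ((k : ℝ) + 1)) * N ≤ ((A ∩ Set.Icc 1 N).ncard : ℝ) := by
    intro k
    refine ⟨n k, (hnP k).1, (hnP k).2.trans ?_⟩
    have hmem : ∀ i ∈ Set.Icc 1 (n k), i ∈ P k → i ∈ A := fun i hi hik =>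
      ⟨hi.1, fun j hj => hP (hn.lt_iff_lt.1 (hj.trans_le hi.2)).le hik⟩
    exact_mod_cast ncard_inter_Icc_mono hmem
  have hinf : A.Infinite := by
    intro hfin
    obtain ⟨N, hN, hcard⟩ := hdens (2 * A.ncard + 1)
    have h1 : ((A ∩ Set.Icc 1 N).ncard : ℝ) ≤ A.ncard := by
      exact_mod_cast Set.ncard_le_ncard Set.inter_subset_left hfin
    have h2 : (1 : ℝ) / (((2 * A.ncard + 1 : ℕ) : ℝ) + 1) ≤ 1 / 2 := by
      apply one_div_le_one_div_of_le (by norm_num)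
      push_cast
      linarith [(Nat.cast_nonneg A.ncard : (0 : ℝ) ≤ A.ncard)]
    have h3 : ((2 * A.ncard + 1 : ℕ) : ℝ) < N := by exact_mod_cast hN
    push_cast at h2 h3 hcard
    have h4 : (1 / 2 : ℝ) * N ≤ (1 - 1 / (2 * (A.ncard : ℝ) + 1 + 1)) * N := by
      gcongr
      linarith
    linarith
  have hmono : StrictMono (Nat.nth (· ∈ A)) := Nat.nth_strictMono hinf
  have hmem : ∀ j, Nat.nth (· ∈ A) j ∈ A := Nat.nth_mem_of_infinite hinf
  refine ⟨Nat.nth (· ∈ A), hmono, fun k => (hmem k).1, ?_, fun k => ?_⟩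
  · have hrange : Set.range (Nat.nth (· ∈ A)) = A := Nat.range_nth_of_infinite hinf
    rw [hrange]
    exact upperDensity_eq_one_of_frequently hdens
  · filter_upwards [hmono.tendsto_atTop.eventually_gt_atTop (n k)] with j hj
    exact (hmem j).2 k hj

theorem isOpen_setOf_le_ncard {E : Type*} [TopologicalSpace E] {f : ℕ → E → ℝ}
    (hf : ∀ i, Continuous (f i)) {U : Set ℝ} (hU : IsOpen U) (c : ℝ) (n : ℕ) :
    IsOpen {x | c ≤ (({i | f i x ∈ U} ∩ Set.Icc 1 n).ncard : ℝ)} := by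
  rw [isOpen_iff_eventually]
  intro x hx
  have hfin : ({i | f i x ∈ U} ∩ Set.Icc 1 n).Finite :=
    (Set.finite_Icc 1 n).subset Set.inter_subset_right
  have : ∀ᶠ y in 𝓝 x, ∀ i ∈ {i | f i x ∈ U} ∩ Set.Icc 1 n, f i y ∈ U := by
    rw [eventually_all_finite hfin]
    exact fun i hi => (hf i).continuousAt.eventually (hU.mem_nhds hi.1)
  filter_upwards [this] with y hy
  refine le_trans (show c ≤ _ from hx) ?_
  exact_mod_cast ncard_inter_Icc_mono fun i hi hix => hy i ⟨hix, hi⟩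

/-- The points at which `f i` belongs to `U` for a proportion at least `1 - 1 / (k + 1)` of the
indices `i ∈ [1, n]`, for some `n > k`. -/
def mostlyIn {E : Type*} (f : ℕ → E → ℝ) (U : Set ℝ) (k : ℕ) : Set E :=
  {x | ∃ n > k, (1 - 1 / ((k : ℝ) + 1)) * n ≤ (({i | f i x ∈ U} ∩ Set.Icc 1 n).ncard : ℝ)}

theorem isOpen_mostlyIn {E : Type*} [TopologicalSpace E] {f : ℕ → E → ℝ}
    (hf : ∀ i, Continuous (f i)) {U : Set ℝ} (hU : IsOpen U) (k : ℕ) :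
    IsOpen (mostlyIn f U k) := by
  have : mostlyIn f U k = ⋃ n : ℕ, ⋃ _ : n > k,
      {x | (1 - 1 / ((k : ℝ) + 1)) * n ≤ (({i | f i x ∈ U} ∩ Set.Icc 1 n).ncard : ℝ)} := by
    ext x
    simp [mostlyIn]
  rw [this]
  exact isOpen_iUnion fun n => isOpen_iUnion fun _ => isOpen_setOf_le_ncard hf hU _ n

theorem mem_mostlyIn_of_eventually {E : Type*} {f : ℕ → E → ℝ} {U : Set ℝ} {x : E}
    (h : ∀ᶠ i in atTop, f i x ∈ U) (k : ℕ) : x ∈ mostlyIn f U k := by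
  obtain ⟨M, hM⟩ := eventually_atTop.1 h
  refine ⟨(k + 1) * (M + 1), by nlinarith, ?_⟩
  have hsub : Set.Icc (M + 1) ((k + 1) * (M + 1)) ⊆
      {i | f i x ∈ U} ∩ Set.Icc 1 ((k + 1) * (M + 1)) := fun i hi =>
    ⟨hM i (by have := hi.1; omega), by have := hi.1; omega, hi.2⟩
  have hcard := Set.ncard_le_ncard hsub ((Set.finite_Icc 1 _).subset Set.inter_subset_right)
  rw [← Finset.coe_Icc, Set.ncard_coe_finset, Nat.card_Icc] at hcard
  have h1 : (k + 1) * (M + 1) ≤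
      ({i | f i x ∈ U} ∩ Set.Icc 1 ((k + 1) * (M + 1))).ncard + M := by omega
  have h2 : (((k + 1) * (M + 1) : ℕ) : ℝ) ≤
      (({i | f i x ∈ U} ∩ Set.Icc 1 ((k + 1) * (M + 1))).ncard : ℝ) + M := by exact_mod_cast h1
  have h3 : (1 - 1 / ((k : ℝ) + 1)) * (((k + 1) * (M + 1) : ℕ) : ℝ) =
      (((k + 1) * (M + 1) : ℕ) : ℝ) - (M + 1) := by
    push_cast
    field_simp
  linarith

theorem ncard_lt_le_ncard_inter_Icc_add_one {A B : Set ℕ} {n : ℕ} (h : ∀ i, i ∈ A → i ∈ B) :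
    {i | i < n ∧ i ∈ A}.ncard ≤ (B ∩ Set.Icc 1 n).ncard + 1 := by
  have hfin : (B ∩ Set.Icc 1 n).Finite := (Set.finite_Icc 1 n).subset Set.inter_subset_right
  refine (Set.ncard_le_ncard (t := insert 0 (B ∩ Set.Icc 1 n)) ?_ (hfin.insert 0)).trans
    (Set.ncard_insert_le _ _)
  rintro i ⟨hi, hiA⟩
  rcases Nat.eq_zero_or_pos i with rfl | h0
  · exact Set.mem_insert _ _
  · exact Set.mem_insert_of_mem _ ⟨h i hiA, h0, hi.le⟩

theorem tendsto_pow_apply_zero_of_mem_span {𝕜 : Type*} [RCLike 𝕜] {X : Type*}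
    [NormedAddCommGroup X] [NormedSpace 𝕜 X] (T : X →L[𝕜] X) {S : Set X}
    (hS : ∀ x ∈ S, Tendsto (fun n : ℕ => (T ^ n) x) atTop (𝓝 0)) {u : X}
    (hu : u ∈ Submodule.span 𝕜 S) : Tendsto (fun n : ℕ => (T ^ n) u) atTop (𝓝 0) := by
  induction hu using Submodule.span_induction with
  | mem x hx => exact hS x hx
  | zero => simp
  | add x y _ _ hx hy => simpa using hx.add hy
  | smul c x _ hx => simpa using hx.const_smul c

theorem exists_mostlyIn_norm_add_lt {𝕜 : Type*} [RCLike 𝕜] {X : Type*}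
    [NormedAddCommGroup X] [NormedSpace 𝕜 X] (T : X →L[𝕜] X) {y : ℕ → X} {N : ℕ → ℕ}
    (hy : ∀ m, y m ≠ 0) (hN : Tendsto N atTop atTop)
    (hlim : Tendsto (fun m : ℕ =>
        (({i : ℕ | i < N m ∧ (m : ℝ) * ‖y m‖ ≤ ‖(T ^ i) (y m)‖}).ncard : ℝ) / N m)
      atTop (𝓝 1)) {u : X} {C : ℝ} (hu : ∀ i : ℕ, ‖(T ^ i) u‖ ≤ C) (k : ℕ) {ε : ℝ}
    (hε : 0 < ε) :
    ∃ (m : ℕ) (c : 𝕜), ‖c • y m‖ < ε ∧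
      u + c • y m ∈ mostlyIn (fun i x => ‖(T ^ i) x‖) (Set.Ioi (k : ℝ)) k := by
  have hδ : (0 : ℝ) < 1 / (2 * ((k : ℝ) + 1)) := by positivity
  have hNr : Tendsto (fun m => (N m : ℝ)) atTop atTop := tendsto_natCast_atTop_atTop.comp hN
  have hlarge : Tendsto (fun m : ℕ => ε / 2 * (m : ℝ)) atTop atTop :=
    tendsto_natCast_atTop_atTop.const_mul_atTop (by positivity)
  obtain ⟨m, hratio, hNk, hNm, hm⟩ := ((hlim.eventually_const_lt (sub_lt_self 1 hδ)).and
    ((hN.eventually_gt_atTop k).and ((hNr.eventually_ge_atTop (2 * ((k : ℝ) + 1))).and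
      (hlarge.eventually_gt_atTop (k + C))))).exists
  have hym : 0 < ‖y m‖ := norm_pos_iff.2 (hy m)
  set c : 𝕜 := ((ε / 2 / ‖y m‖ : ℝ) : 𝕜) with hc
  have hcn : ‖c‖ = ε / 2 / ‖y m‖ := by
    rw [hc, RCLike.norm_ofReal, abs_of_pos (by positivity)]
  refine ⟨m, c, ?_, N m, hNk, ?_⟩
  · rw [norm_smul, hcn, div_mul_cancel₀ _ hym.ne']
    linarith
  have hN0 : (0 : ℝ) < N m := lt_of_lt_of_le (by positivity) hNm
  have hcard := ncard_lt_le_ncard_inter_Icc_add_one (n := N m)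
    (A := {i | (m : ℝ) * ‖y m‖ ≤ ‖(T ^ i) (y m)‖})
    (B := {i | ‖(T ^ i) (u + c • y m)‖ ∈ Set.Ioi (k : ℝ)}) (by
      intro i hi
      have h1 : ε / 2 * m ≤ ‖(T ^ i) (c • y m)‖ := by
        rw [map_smul, norm_smul, hcn]
        calc ε / 2 * m = ε / 2 / ‖y m‖ * (m * ‖y m‖) := by field_simp
          _ ≤ _ := mul_le_mul_of_nonneg_left hi (by positivity)
      have h2 : ‖(T ^ i) (c • y m)‖ ≤ ‖(T ^ i) (u + c • y m)‖ + ‖(T ^ i) u‖ := by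
        have := norm_sub_le ((T ^ i) (u + c • y m)) ((T ^ i) u)
        rwa [map_add, add_sub_cancel_left, ← map_add] at this
      have h3 := hu i
      simp only [Set.mem_ofPred_eq, Set.mem_Ioi]
      linarith)
  have hcard' : (({i : ℕ | i < N m ∧ (m : ℝ) * ‖y m‖ ≤ ‖(T ^ i) (y m)‖}).ncard : ℝ) ≤
      (({i | ‖(T ^ i) (u + c • y m)‖ ∈ Set.Ioi (k : ℝ)} ∩ Set.Icc 1 (N m)).ncard : ℝ) + 1 := by
    exact_mod_cast hcard
  rw [lt_div_iff₀ hN0] at hratio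
  have hone : 1 ≤ 1 / (2 * ((k : ℝ) + 1)) * N m := by
    rw [one_div_mul_eq_div, le_div_iff₀ (by positivity)]
    linarith
  have hsplit : (1 - 1 / ((k : ℝ) + 1)) * N m =
      (1 - 1 / (2 * ((k : ℝ) + 1))) * N m - 1 / (2 * ((k : ℝ) + 1)) * N m := by
    field_simp
    ring
  rw [hsplit]
  linarith

theorem distIrregularVector_of_mem_mostlyIn {𝕜 : Type*} [RCLike 𝕜] {X : Type*}
    [NormedAddCommGroup X] [NormedSpace 𝕜 X] (T : X →L[𝕜] X) {x : X}
    (hsmall : ∀ k : ℕ,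
      x ∈ mostlyIn (fun i z => ‖(T ^ i) z‖) (Set.Iio (1 / ((k : ℝ) + 1))) k)
    (hlarge : ∀ k : ℕ, x ∈ mostlyIn (fun i z => ‖(T ^ i) z‖) (Set.Ioi (k : ℝ)) k) :
    DistIrregularVector T x := by
  obtain ⟨a, ha, ha0, hda, haP⟩ := exists_pseudoIntersection_upperDensity_eq_one
    (P := fun k => {i | ‖(T ^ i) x‖ ∈ Set.Iio (1 / ((k : ℝ) + 1))})
    (fun k l hkl i (hi : ‖(T ^ i) x‖ < 1 / ((l : ℝ) + 1)) =>
      show ‖(T ^ i) x‖ < 1 / ((k : ℝ) + 1) from hi.trans_le (Nat.one_div_le_one_div hkl)) hsmall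
  obtain ⟨b, hb, hb0, hdb, hbP⟩ := exists_pseudoIntersection_upperDensity_eq_one
    (P := fun k => {i | ‖(T ^ i) x‖ ∈ Set.Ioi (k : ℝ)})
    (fun k l hkl i (hi : (l : ℝ) < ‖(T ^ i) x‖) =>
      show (k : ℝ) < ‖(T ^ i) x‖ from (Nat.cast_le.2 hkl).trans_lt hi) hlarge
  refine ⟨a, b, ha, hb, ha0, hb0, hda, hdb, ?_, ?_⟩
  · rw [tendsto_order]
    refine ⟨fun c hc => Eventually.of_forall fun j => hc.trans_le (norm_nonneg _), fun c hc => ?_⟩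
    obtain ⟨k, hk⟩ := exists_nat_one_div_lt hc
    filter_upwards [haP k] with j hj
    exact lt_trans hj hk
  · rw [tendsto_atTop]
    intro c
    obtain ⟨k, hk⟩ := exists_nat_ge c
    filter_upwards [hbP k] with j hj
    exact hk.trans (le_of_lt hj)

/-- If `T` satisfies the Distributional Chaos Criterion, then `T` admits a distributionally
irregular vector. -/
theorem distIrregularVector_of_DCC
    {𝕜 : Type*} [RCLike 𝕜] {X : Type*} [NormedAddCommGroup X] [NormedSpace 𝕜 X]
    [CompleteSpace X] (T : X →L[𝕜] X) (h : DCCriterion T) :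
    ∃ x : X, DistIrregularVector T x := by
  obtain ⟨x, y, N, -, hy, hyx, hx, -, -, hN, hlim⟩ := h
  set S : Submodule 𝕜 X := Submodule.span 𝕜 (Set.range x)
  set Y : Submodule 𝕜 X := S.topologicalClosure
  have : CompleteSpace Y := S.isClosed_topologicalClosure.completeSpace_coe
  have hzero : ∀ u ∈ S, Tendsto (fun n : ℕ => (T ^ n) u) atTop (𝓝 0) := fun u hu =>
    tendsto_pow_apply_zero_of_mem_span T (by rintro _ ⟨m, rfl⟩; exact hx m) hu
  have hdense : Dense {u : Y | (u : X) ∈ S} := by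
    rw [Subtype.dense_iff]
    intro u hu
    refine closure_mono ?_ hu
    intro v hv
    exact ⟨⟨v, S.le_topologicalClosure hv⟩, hv, rfl⟩
  have hcont : ∀ i : ℕ, Continuous fun z : X => ‖(T ^ i) z‖ := fun i => (T ^ i).continuous.norm
  have hsmall : Dense (⋂ k : ℕ, ((↑) : Y → X) ⁻¹'
      mostlyIn (fun i z => ‖(T ^ i) z‖) (Set.Iio (1 / ((k : ℝ) + 1))) k) := by
    refine hdense.mono fun u hu => Set.mem_iInter.2 fun k => mem_mostlyIn_of_eventually ?_ k
    exact (tendsto_zero_iff_norm_tendsto_zero.1 (hzero u hu)).eventually_lt_const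
      Nat.one_div_pos_of_nat
  have hlarge : ∀ k : ℕ, Dense (((↑) : Y → X) ⁻¹'
      mostlyIn (fun i z => ‖(T ^ i) z‖) (Set.Ioi (k : ℝ)) k) := by
    intro k
    refine dense_closure.1 (hdense.mono fun u hu => Metric.mem_closure_iff.2 fun ε hε => ?_)
    obtain ⟨C, hC⟩ := (hzero u hu).norm.bddAbove_range
    have hC' : ∀ i : ℕ, ‖(T ^ i) (u : X)‖ ≤ C := fun i => hC (Set.mem_range_self i)
    obtain ⟨m, c, hc, hmem⟩ := exists_mostlyIn_norm_add_lt T hy hN hlim hC' k hε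
    let w : Y := ⟨y m, hyx m⟩
    refine ⟨u + c • w, hmem, ?_⟩
    rw [dist_self_add_right]
    exact hc
  have hopen : ∀ {U : Set ℝ}, IsOpen U → ∀ k : ℕ,
      IsOpen (((↑) : Y → X) ⁻¹' mostlyIn (fun i z => ‖(T ^ i) z‖) U k) := fun hU k =>
    (isOpen_mostlyIn hcont hU k).preimage continuous_subtype_val
  obtain ⟨z, hz₁, hz₂⟩ := (hsmall.inter_of_Gδ (.iInter_of_isOpen fun k => hopen isOpen_Iio k)
    (.iInter_of_isOpen fun k => hopen isOpen_Ioi k)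
    (dense_iInter_of_isOpen (fun k => hopen isOpen_Ioi k) hlarge)).nonempty
  rw [Set.mem_iInter] at hz₁ hz₂
  exact ⟨z, distIrregularVector_of_mem_mostlyIn T hz₁ hz₂⟩
end

section
/- Every infinite-dimensional separable Banach space X admits a bounded linear operator T : X → X that is hypercyclic and distributionally chaotic, and which admits a dense distributionally irregular manifold. -/
open Filter Topology
open scoped ENNReal

section Density

theorem ncard_inter_Icc_div_le_one (A : Set ℕ) (n : ℕ) :
    ((A ∩ Set.Icc 1 n).ncard : ℝ) / n ≤ 1 := by
  rcases Nat.eq_zero_or_pos n with rfl | hn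
  · simp
  · rw [div_le_one (by positivity)]
    have h : (A ∩ Set.Icc 1 n).ncard ≤ (Set.Icc 1 n).ncard :=
      Set.ncard_le_ncard Set.inter_subset_right (Set.finite_Icc 1 n)
    rw [Set.ncard_eq_toFinset_card' (Set.Icc 1 n), Set.toFinset_Icc, Nat.card_Icc] at h
    exact_mod_cast h

theorem isBoundedUnder_le_ncard_div (A : Set ℕ) :
    IsBoundedUnder (· ≤ ·) atTop (fun n : ℕ => ((A ∩ Set.Icc 1 n).ncard : ℝ) / n) :=
  isBoundedUnder_of ⟨1, ncard_inter_Icc_div_le_one A⟩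

theorem isBoundedUnder_ge_ncard_div (A : Set ℕ) :
    IsBoundedUnder (· ≥ ·) atTop (fun n : ℕ => ((A ∩ Set.Icc 1 n).ncard : ℝ) / n) :=
  isBoundedUnder_of ⟨0, fun _ => by positivity⟩

/-- An interval `[N / (M + 1), N]` contains a proportion at least `1 - 1 / (M + 1)` of `[1, N]`. -/
theorem one_sub_le_ncard_div {A : Set ℕ} {M N : ℕ} (hN : 0 < N)
    (h : ∀ i ≤ N, N ≤ (M + 1) * i → i ∈ A) :
    1 - 1 / ((M : ℝ) + 1) ≤ ((A ∩ Set.Icc 1 N).ncard : ℝ) / N := by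
  have hsub : Set.Ioc (N / (M + 1)) N ⊆ A ∩ Set.Icc 1 N := by
    rintro i ⟨h1, h2⟩
    refine ⟨h i h2 ?_, Nat.succ_le_of_lt (h1.trans_le' (Nat.zero_le _)), h2⟩
    rw [Nat.div_lt_iff_lt_mul (by omega)] at h1
    rw [mul_comm]; exact h1.le
  have hc : (Set.Ioc (N / (M + 1)) N).ncard ≤ (A ∩ Set.Icc 1 N).ncard :=
    Set.ncard_le_ncard hsub ((Set.finite_Icc 1 N).subset Set.inter_subset_right)
  rw [Set.ncard_eq_toFinset_card' (Set.Ioc (N / (M + 1)) N), Set.toFinset_Ioc, Nat.card_Ioc] at hc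
  have hc' : (N : ℝ) ≤ (A ∩ Set.Icc 1 N).ncard + ((N / (M + 1) : ℕ) : ℝ) := by
    exact_mod_cast Nat.sub_le_iff_le_add.mp hc
  have hd : ((N / (M + 1) : ℕ) : ℝ) ≤ N / ((M : ℝ) + 1) := by
    have := @Nat.cast_div_le ℝ _ _ _ N (M + 1)
    push_cast at this
    exact this
  have hN' : (0 : ℝ) < N := by exact_mod_cast hN
  rw [le_div_iff₀ hN']
  calc (1 - 1 / ((M : ℝ) + 1)) * N = N - N / ((M : ℝ) + 1) := by ring
    _ ≤ _ := by linarith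

theorem upperDensity_eq_one {A : Set ℕ}
    (h : ∀ M : ℕ, ∃ N, M ≤ N ∧ 0 < N ∧ ∀ i ≤ N, N ≤ (M + 1) * i → i ∈ A) :
    upperDensity A = 1 := by
  apply le_antisymm
  · exact limsup_le_of_le (isBoundedUnder_ge_ncard_div A).isCoboundedUnder_le
      (Eventually.of_forall (ncard_inter_Icc_div_le_one A))
  · apply le_of_forall_lt
    intro c hc
    obtain ⟨m, hm⟩ := exists_nat_one_div_lt (sub_pos.2 hc)
    refine lt_of_lt_of_le (b := 1 - 1 / ((m : ℝ) + 1)) (by linarith) ?_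
    apply le_limsup_of_frequently_le _ (isBoundedUnder_le_ncard_div A)
    rw [frequently_atTop]
    intro a
    obtain ⟨N, h1, h2, h3⟩ := h (max a m)
    refine ⟨N, (le_max_left _ _).trans h1, ?_⟩
    refine le_trans ?_ (one_sub_le_ncard_div h2 h3)
    have : (m : ℝ) ≤ (max a m : ℕ) := by exact_mod_cast le_max_right a m
    gcongr

theorem lowerDensity_eq_zero {A : Set ℕ}
    (h : ∀ M : ℕ, ∃ N, M ≤ N ∧ 0 < N ∧ ∀ i ≤ N, N ≤ (M + 1) * i → i ∉ A) :
    lowerDensity A = 0 := by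
  apply le_antisymm
  · apply le_of_forall_gt
    intro c hc
    obtain ⟨m, hm⟩ := exists_nat_one_div_lt hc
    refine lt_of_le_of_lt (b := 1 / ((m : ℝ) + 1)) ?_ hm
    apply liminf_le_of_frequently_le _ (isBoundedUnder_ge_ncard_div A)
    rw [frequently_atTop]
    intro a
    obtain ⟨N, h1, h2, h3⟩ := h (max a m)
    refine ⟨N, (le_max_left _ _).trans h1, ?_⟩
    have hA := one_sub_le_ncard_div (A := Aᶜ) h2 h3
    have hsum : (A ∩ Set.Icc 1 N).ncard + (Aᶜ ∩ Set.Icc 1 N).ncard ≤ N := by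
      rw [← Set.ncard_union_eq]
      · have : (A ∩ Set.Icc 1 N ∪ Aᶜ ∩ Set.Icc 1 N).ncard ≤ (Set.Icc 1 N).ncard :=
          Set.ncard_le_ncard (Set.union_subset Set.inter_subset_right Set.inter_subset_right)
            (Set.finite_Icc 1 N)
        rwa [Set.ncard_eq_toFinset_card' (Set.Icc 1 N), Set.toFinset_Icc, Nat.card_Icc] at this
      · exact (disjoint_compl_right (a := A)).mono Set.inter_subset_left Set.inter_subset_left
    have hN' : (0 : ℝ) < N := by exact_mod_cast h2
    have hsum' : ((A ∩ Set.Icc 1 N).ncard : ℝ) / N + ((Aᶜ ∩ Set.Icc 1 N).ncard : ℝ) / N ≤ 1 := by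
      rw [← add_div, div_le_one hN']
      exact_mod_cast hsum
    have hle : 1 / (((max a m : ℕ) : ℝ) + 1) ≤ 1 / ((m : ℝ) + 1) := by
      have : (m : ℝ) ≤ (max a m : ℕ) := by exact_mod_cast le_max_right a m
      gcongr
    linarith
  · exact le_liminf_of_le (isBoundedUnder_le_ncard_div A).isCoboundedUnder_ge
      (Eventually.of_forall fun _ => by positivity)

/-- Long intervals on which `P M` holds, for every `M`, can be merged into a single sequence of
upper density one along which `P M` holds for larger and larger `M`. -/
theorem exists_strictMono_upperDensity_eq_one {P : ℕ → ℕ → Prop}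
    (h : ∀ M : ℕ, ∃ N, M ≤ N ∧ 0 < N ∧ ∀ i ≤ N, N ≤ (M + 1) * i → P M i) :
    ∃ a : ℕ → ℕ, StrictMono a ∧ (∀ k, 0 < a k) ∧ upperDensity (Set.range a) = 1 ∧
      ∀ M₀, ∀ᶠ k in atTop, ∃ M ≥ M₀, P M (a k) := by
  choose N hN1 hN2 hN3 using h
  let A : Set ℕ := {i | ∃ M, i ≤ N M ∧ N M ≤ (M + 1) * i}
  have hinf : A.Infinite := by
    rw [Set.infinite_iff_exists_gt]
    intro m
    refine ⟨N (m + 1), ⟨m + 1, le_rfl, Nat.le_mul_of_pos_left _ (by omega)⟩, ?_⟩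
    have := hN1 (m + 1)
    omega
  have hrange : Set.range (Nat.nth (· ∈ A)) = A := Nat.range_nth_of_infinite hinf
  have hmem : ∀ k, Nat.nth (· ∈ A) k ∈ A := fun k => Nat.nth_mem_of_infinite hinf k
  have hmono : StrictMono (Nat.nth (· ∈ A)) := Nat.nth_strictMono hinf
  refine ⟨Nat.nth (· ∈ A), hmono, ?_, ?_, ?_⟩
  · intro k
    obtain ⟨M, -, h2⟩ := hmem k
    have := hN2 M
    exact Nat.pos_of_ne_zero fun h0 => by simp [h0] at h2; omega
  · rw [hrange]
    exact upperDensity_eq_one fun M => ⟨N M, hN1 M, hN2 M, fun i h1 h2 => ⟨M, h1, h2⟩⟩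
  · intro M₀
    have hev : ∀ᶠ k in atTop, ∑ M ∈ Finset.range M₀, N M < Nat.nth (· ∈ A) k :=
      hmono.tendsto_atTop.eventually_gt_atTop _
    filter_upwards [hev] with k hk
    obtain ⟨M, h1, h2⟩ := hmem k
    refine ⟨M, ?_, hN3 M _ h1 h2⟩
    by_contra hlt
    have : N M ≤ ∑ M ∈ Finset.range M₀, N M :=
      Finset.single_le_sum (fun _ _ => Nat.zero_le _) (Finset.mem_range.2 (not_le.1 hlt))
    omega

end Density

section Baire

variable {𝕜 : Type*} [RCLike 𝕜] {X : Type*} [NormedAddCommGroup X] [NormedSpace 𝕜 X]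

/-- The orbit of `x` is uniformly small on arbitrarily long intervals `[N / (M + 1), N]`, and
uniformly large on other such intervals. -/
def IntervalIrregular (T : X →L[𝕜] X) (x : X) : Prop :=
  (∀ M : ℕ, ∃ N, M ≤ N ∧ 0 < N ∧
    ∀ i ≤ N, N ≤ (M + 1) * i → ‖(T ^ i) x‖ < 1 / ((M : ℝ) + 1)) ∧
  (∀ M : ℕ, ∃ N, M ≤ N ∧ 0 < N ∧ ∀ i ≤ N, N ≤ (M + 1) * i → (M : ℝ) < ‖(T ^ i) x‖)

theorem IntervalIrregular.distIrregularVector {T : X →L[𝕜] X} {x : X}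
    (h : IntervalIrregular T x) : DistIrregularVector T x := by
  obtain ⟨a, ha1, ha2, ha3, ha4⟩ := exists_strictMono_upperDensity_eq_one
    (P := fun M i => ‖(T ^ i) x‖ < 1 / ((M : ℝ) + 1)) h.1
  obtain ⟨b, hb1, hb2, hb3, hb4⟩ := exists_strictMono_upperDensity_eq_one
    (P := fun M i => (M : ℝ) < ‖(T ^ i) x‖) h.2
  refine ⟨a, b, ha1, hb1, ha2, hb2, ha3, hb3, ?_, ?_⟩
  · rw [Metric.tendsto_nhds]
    intro ε hε
    obtain ⟨m, hm⟩ := exists_nat_one_div_lt hε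
    filter_upwards [ha4 m] with k hk
    obtain ⟨M, hM, hlt⟩ := hk
    rw [Real.dist_eq, sub_zero, abs_norm]
    refine hlt.trans_le (le_trans ?_ hm.le)
    have : (m : ℝ) ≤ M := by exact_mod_cast hM
    gcongr
  · rw [tendsto_atTop]
    intro c
    obtain ⟨m, hm⟩ := exists_nat_gt c
    filter_upwards [hb4 m] with k hk
    obtain ⟨M, hM, hlt⟩ := hk
    have : (m : ℝ) ≤ M := by exact_mod_cast hM
    linarith

theorem IntervalIrregular.lowerDensity_eq_zero {T : X →L[𝕜] X} {x : X}
    (h : IntervalIrregular T x) (ε : ℝ) : lowerDensity {n : ℕ | ‖(T ^ n) x‖ < ε} = 0 := by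
  apply _root_.lowerDensity_eq_zero
  intro M
  obtain ⟨m, hm⟩ := exists_nat_gt ε
  obtain ⟨N, h1, h2, h3⟩ := h.2 (max M m)
  refine ⟨N, (le_max_left _ _).trans h1, h2, fun i hi hi' hlt => ?_⟩
  have hle : (M + 1) * i ≤ (max M m + 1) * i := by
    gcongr
    exact le_max_left _ _
  have := h3 i hi (hi'.trans hle)
  have hm' : (m : ℝ) ≤ (max M m : ℕ) := by exact_mod_cast le_max_right M m
  have hlt' : ‖(T ^ i) x‖ < ε := hlt
  linarith

theorem IntervalIrregular.upperDensity_eq_one {T : X →L[𝕜] X} {x : X}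
    (h : IntervalIrregular T x) {τ : ℝ} (hτ : 0 < τ) :
    upperDensity {n : ℕ | ‖(T ^ n) x‖ < τ} = 1 := by
  apply _root_.upperDensity_eq_one
  intro M
  obtain ⟨m, hm⟩ := exists_nat_one_div_lt hτ
  obtain ⟨N, h1, h2, h3⟩ := h.1 (max M m)
  refine ⟨N, (le_max_left _ _).trans h1, h2, fun i hi hi' => ?_⟩
  have hle : (M + 1) * i ≤ (max M m + 1) * i := by
    gcongr
    exact le_max_left _ _
  have hm' : (m : ℝ) ≤ (max M m : ℕ) := by exact_mod_cast le_max_right M m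
  refine (h3 i hi (hi'.trans hle)).trans_le (le_trans ?_ hm.le)
  gcongr

theorem distChaotic_of_intervalIrregular {T : X →L[𝕜] X} {x : X} (hx : x ≠ 0)
    (h : ∀ c : 𝕜, c ≠ 0 → IntervalIrregular T (c • x)) : DistChaotic T := by
  have hinj : Function.Injective fun t : ℝ => (t : 𝕜) • x := by
    intro s t hst
    exact_mod_cast smul_left_injective 𝕜 hx hst
  refine ⟨Set.range fun t : ℝ => (t : 𝕜) • x, 1, one_pos, ?_, ?_⟩
  · intro hc
    rw [← Set.image_univ] at hc
    exact Cardinal.not_countable_real (Set.countable_of_injective_of_countable_image hinj.injOn hc)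
  · rintro _ ⟨s, rfl⟩ _ ⟨t, rfl⟩ hne
    have hst : (s : 𝕜) - t ≠ 0 := by
      rw [sub_ne_zero]
      exact fun h => hne (by simp only [h])
    have hsub : ∀ n, (T ^ n) ((s : 𝕜) • x) - (T ^ n) ((t : 𝕜) • x) =
        (T ^ n) (((s : 𝕜) - t) • x) := fun n => by rw [sub_smul, map_sub]
    simp only [hsub]
    exact ⟨(h _ hst).lowerDensity_eq_zero 1, fun τ hτ => (h _ hst).upperDensity_eq_one hτ⟩

/-- A combination of vectors that are simultaneously small on long intervals, and one of which is
large while the others are bounded on long intervals, is interval irregular. -/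
theorem intervalIrregular_of_mem_span {T : X →L[𝕜] X} {x : ℕ → X}
    (hsmall : ∀ M : ℕ, ∃ N, M ≤ N ∧ 0 < N ∧
      ∀ i ≤ N, N ≤ (M + 1) * i → ∀ l < M, ‖(T ^ i) (x l)‖ < 1 / ((M : ℝ) + 1))
    (hlarge : ∀ j M : ℕ, ∃ N, M ≤ N ∧ 0 < N ∧ ∀ i ≤ N, N ≤ (M + 1) * i →
      (M : ℝ) < ‖(T ^ i) (x j)‖ ∧ ∀ l < M, l ≠ j → ‖(T ^ i) (x l)‖ < 1)
    {y : X} (hy : y ∈ Submodule.span 𝕜 (Set.range x)) (hy0 : y ≠ 0) :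
    IntervalIrregular T y := by
  obtain ⟨c, rfl⟩ := (Finsupp.mem_span_range_iff_exists_finsupp).1 hy
  have hc : c ≠ 0 := by
    rintro rfl
    simp at hy0
  obtain ⟨j, hj⟩ := Finsupp.ne_iff.1 hc
  rw [Finsupp.coe_zero, Pi.zero_apply] at hj
  have hT : ∀ i, (T ^ i) (c.sum fun l a => a • x l) = ∑ l ∈ c.support, c l • (T ^ i) (x l) := by
    intro i
    rw [Finsupp.sum, map_sum]
    simp only [map_smul]
  obtain ⟨s, hs⟩ : ∃ s, ∀ l ∈ c.support, l < s :=
    ⟨c.support.sup id + 1, fun l hl => Nat.lt_succ_of_le (Finset.le_sup (f := id) hl)⟩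
  set S : ℝ := ∑ l ∈ c.support, ‖c l‖ with hS
  have hS0 : 0 ≤ S := Finset.sum_nonneg fun _ _ => norm_nonneg _
  constructor
  · intro M
    obtain ⟨m, hm⟩ := exists_nat_gt (S * (M + 1))
    set M' := max M (max m s) with hM'
    have h1 : M ≤ M' := le_max_left _ _
    have h2 : m ≤ M' := (le_max_left _ _).trans (le_max_right _ _)
    have h3 : s ≤ M' := (le_max_right _ _).trans (le_max_right _ _)
    obtain ⟨N, hN1, hN2, hN3⟩ := hsmall M'
    refine ⟨N, h1.trans hN1, hN2, fun i hi hi' => ?_⟩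
    have hb := hN3 i hi (hi'.trans (by gcongr))
    rw [hT]
    have hm' : (m : ℝ) ≤ M' := by exact_mod_cast h2
    calc ‖∑ l ∈ c.support, c l • (T ^ i) (x l)‖ 
        ≤ ∑ l ∈ c.support, ‖c l • (T ^ i) (x l)‖ := norm_sum_le _ _
      _ ≤ ∑ l ∈ c.support, ‖c l‖ * (1 / ((M' : ℝ) + 1)) := by
          refine Finset.sum_le_sum fun l hl => ?_
          rw [norm_smul]
          exact mul_le_mul_of_nonneg_left (hb l ((hs l hl).trans_le h3)).le (norm_nonneg _)
      _ = S / ((M' : ℝ) + 1) := by rw [← Finset.sum_mul]; ring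
      _ < 1 / ((M : ℝ) + 1) := by
          rw [div_lt_div_iff₀ (by positivity) (by positivity)]
          linarith
  · intro M
    have hcj : 0 < ‖c j‖ := norm_pos_iff.2 hj
    obtain ⟨m, hm⟩ := exists_nat_gt ((M + S) / ‖c j‖)
    rw [div_lt_iff₀ hcj] at hm
    set M' := max M (max m s) with hM'
    have h1 : M ≤ M' := le_max_left _ _
    have h2 : m ≤ M' := (le_max_left _ _).trans (le_max_right _ _)
    have h3 : s ≤ M' := (le_max_right _ _).trans (le_max_right _ _)
    obtain ⟨N, hN1, hN2, hN3⟩ := hlarge j M'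
    refine ⟨N, h1.trans hN1, hN2, fun i hi hi' => ?_⟩
    obtain ⟨hb, hb'⟩ := hN3 i hi (hi'.trans (by gcongr))
    have hm' : (m : ℝ) ≤ M' := by exact_mod_cast h2
    have hjs : j ∈ c.support := Finsupp.mem_support_iff.2 hj
    rw [hT, ← Finset.add_sum_erase _ _ hjs]
    have hrest : ‖∑ l ∈ c.support.erase j, c l • (T ^ i) (x l)‖ ≤ S := by
      calc ‖∑ l ∈ c.support.erase j, c l • (T ^ i) (x l)‖
          ≤ ∑ l ∈ c.support.erase j, ‖c l • (T ^ i) (x l)‖ := norm_sum_le _ _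
        _ ≤ ∑ l ∈ c.support.erase j, ‖c l‖ := by
            refine Finset.sum_le_sum fun l hl => ?_
            rw [norm_smul]
            obtain ⟨hl1, hl2⟩ := Finset.mem_erase.1 hl
            exact mul_le_of_le_one_right (norm_nonneg _)
              (hb' l ((hs l hl2).trans_le h3) hl1).le
        _ ≤ S := Finset.sum_le_sum_of_subset_of_nonneg (Finset.erase_subset _ _)
            fun _ _ _ => norm_nonneg _
    have hmain : (M : ℝ) + S < ‖c j • (T ^ i) (x j)‖ := by
      rw [norm_smul]
      nlinarith
    have := norm_sub_le_norm_add (c j • (T ^ i) (x j))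
      (∑ l ∈ c.support.erase j, c l • (T ^ i) (x l))
    linarith

/-- Simultaneous approximability by vectors small on long intervals, together with one orbit
tending to infinity, yields a dense interval irregular manifold. -/
theorem exists_dense_submodule_intervalIrregular [CompleteSpace X]
    [TopologicalSpace.SeparableSpace X] {T : X →L[𝕜] X} {D : Set X} (hD : Dense D)
    {y : ℕ → X → X} {N : ℕ → ℕ} (hN : Tendsto N atTop atTop)
    (hy : ∀ x ∈ D, ∀ ε > (0 : ℝ), ∀ᶠ j in atTop, ‖y j x - x‖ < ε ∧
      ∀ n ≤ N j, N j ≤ (j + 1) * n → ‖(T ^ n) (y j x)‖ < ε)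
    {z : X} (hz : Tendsto (fun n : ℕ => ‖(T ^ n) z‖) atTop atTop) :
    ∃ Y : Submodule 𝕜 X, Dense (Y : Set X) ∧ ∀ y ∈ Y, y ≠ 0 → IntervalIrregular T y := by
  have : SecondCountableTopology X := UniformSpace.secondCountable_of_separable X
  have hDpi : Dense (Set.univ.pi fun _ : ℕ => D) := dense_pi _ fun _ _ => hD
  have hcont : ∀ (i l : ℕ), Continuous fun x : ℕ → X => ‖(T ^ i) (x l)‖ := fun i l =>
    ((T ^ i).continuous.comp (continuous_apply l)).norm
  have hlim : ∀ x ∈ Set.univ.pi fun _ : ℕ => D,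
      Tendsto (fun j => fun l => y j (x l)) atTop (𝓝 x) := by
    intro x hx
    rw [tendsto_pi_nhds]
    intro l
    rw [Metric.tendsto_nhds]
    intro ε hε
    filter_upwards [hy (x l) (hx l trivial) ε hε] with j hj
    rw [dist_eq_norm]
    exact hj.1
  have hsm : ∀ x ∈ Set.univ.pi fun _ : ℕ => D, ∀ M : ℕ, ∀ ε > (0 : ℝ), ∀ᶠ j in atTop,
      ∀ l < M, ∀ n ≤ N j, N j ≤ (j + 1) * n → ‖(T ^ n) (y j (x l))‖ < ε := by
    intro x hx M ε hε
    have : ∀ᶠ j in atTop, ∀ l ∈ Finset.range M,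
        ∀ n ≤ N j, N j ≤ (j + 1) * n → ‖(T ^ n) (y j (x l))‖ < ε := by
      rw [Filter.eventually_all_finset]
      intro l _
      filter_upwards [hy (x l) (hx l trivial) ε hε] with j hj using hj.2
    simpa only [Finset.mem_range] using this
  let O₁ : ℕ → Set (ℕ → X) := fun M => ⋃ N ∈ {N : ℕ | M ≤ N ∧ 0 < N},
    ⋂ i ∈ {i : ℕ | i ≤ N ∧ N ≤ (M + 1) * i}, ⋂ l ∈ Set.Iio M,
      {x | ‖(T ^ i) (x l)‖ < 1 / ((M : ℝ) + 1)}
  let O₂ : ℕ × ℕ → Set (ℕ → X) := fun p => ⋃ N ∈ {N : ℕ | p.2 ≤ N ∧ 0 < N},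
    ⋂ i ∈ {i : ℕ | i ≤ N ∧ N ≤ (p.2 + 1) * i}, {x | (p.2 : ℝ) < ‖(T ^ i) (x p.1)‖} ∩
      ⋂ l ∈ {l : ℕ | l < p.2 ∧ l ≠ p.1}, {x | ‖(T ^ i) (x l)‖ < 1}
  let O₃ : TopologicalSpace.countableBasis X → Set (ℕ → X) := fun U => ⋃ l, {x | x l ∈ U.1}
  have hfin : ∀ N M : ℕ, {i : ℕ | i ≤ N ∧ N ≤ (M + 1) * i}.Finite := fun N M =>
    (Set.finite_Iic N).subset fun i hi => hi.1
  have hO₁ : ∀ M, IsOpen (O₁ M) := fun M =>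
    isOpen_biUnion fun N _ => (hfin N M).isOpen_biInter fun i _ =>
      (Set.finite_Iio M).isOpen_biInter fun l _ => isOpen_lt (hcont i l) continuous_const
  have hO₂ : ∀ p, IsOpen (O₂ p) := fun p =>
    isOpen_biUnion fun N _ => (hfin N p.2).isOpen_biInter fun i _ =>
      (isOpen_lt continuous_const (hcont i p.1)).inter
        (((Set.finite_Iio p.2).subset fun l hl => hl.1).isOpen_biInter fun l _ =>
          isOpen_lt (hcont i l) continuous_const)
  have hO₃ : ∀ U, IsOpen (O₃ U) := fun U => isOpen_iUnion fun l =>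
    (TopologicalSpace.isOpen_of_mem_countableBasis U.2).preimage (continuous_apply l)
  have hdense : ∀ {O : Set (ℕ → X)}, (∀ x ∈ Set.univ.pi fun _ : ℕ => D, x ∈ closure O) →
      Dense O := by
    intro O h
    rw [← dense_closure]
    exact hDpi.mono h
  have hmul : ∀ {M j n : ℕ}, M ≤ j → (M + 1) * n ≤ (j + 1) * n := by
    intro M j n h
    gcongr
  have hd₁ : ∀ M, Dense (O₁ M) := by
    intro M
    refine hdense fun x hx => mem_closure_of_tendsto (hlim x hx) ?_
    filter_upwards [hsm x hx M (1 / ((M : ℝ) + 1)) (by positivity), hN.eventually_ge_atTop (M + 1),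
      eventually_ge_atTop M] with j h1 h2 h3
    simp only [O₁, Set.mem_iUnion, Set.mem_iInter]
    exact ⟨N j, ⟨by omega, by omega⟩, fun i hi l hl => h1 l hl i hi.1 (hi.2.trans (hmul h3))⟩
  have hd₂ : ∀ p, Dense (O₂ p) := by
    rintro ⟨k, M⟩
    refine hdense fun x hx => ?_
    have key : ∀ δ : ℝ, 0 < δ → x + Pi.single k ((δ : 𝕜) • z) ∈ closure (O₂ (k, M)) := by
      intro δ hδ
      have ht : Tendsto (fun j => (fun l => y j (x l)) + Pi.single k ((δ : 𝕜) • z)) atTop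
          (𝓝 (x + Pi.single k ((δ : 𝕜) • z))) := (hlim x hx).add_const _
      refine mem_closure_of_tendsto ht ?_
      obtain ⟨i₀, hi₀⟩ := eventually_atTop.1 (hz.eventually_gt_atTop ((M + 1) / δ))
      filter_upwards [hsm x hx (M + k + 1) 1 one_pos, hN.eventually_ge_atTop (M + 1),
        hN.eventually_ge_atTop ((M + 1) * i₀ + 1), eventually_ge_atTop M] with j h1 h2 h2' h3
      simp only [O₂, Set.mem_iUnion, Set.mem_iInter]
      refine ⟨N j, ⟨by omega, by omega⟩, fun i hi => ⟨?_, ?_⟩⟩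
      · have hi' : i₀ ≤ i := by
          by_contra hlt
          have : (M + 1) * i ≤ (M + 1) * i₀ := Nat.mul_le_mul_left _ (not_le.1 hlt).le
          have : N j ≤ (M + 1) * i := hi.2
          omega
        have hz' := hi₀ i hi'
        rw [div_lt_iff₀ hδ] at hz'
        have hs := h1 k (by omega) i hi.1 (hi.2.trans (hmul h3))
        have hn : ‖(T ^ i) ((δ : 𝕜) • z)‖ = δ * ‖(T ^ i) z‖ := by
          rw [map_smul, norm_smul, RCLike.norm_ofReal, abs_of_pos hδ]
        have := norm_sub_le_norm_add ((T ^ i) ((δ : 𝕜) • z)) ((T ^ i) (y j (x k)))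
        simp only [Set.mem_ofPred_eq, Pi.add_apply, Pi.single_eq_same, map_add]
        rw [add_comm]
        rw [hn] at this
        linarith
      · refine Set.mem_iInter₂.2 fun l hl => ?_
        have hl1 : l < M := hl.1
        have hl2 : l ≠ k := hl.2
        simp only [Set.mem_ofPred_eq, Pi.add_apply, Pi.single_eq_of_ne hl2, add_zero]
        exact h1 l (by omega) i hi.1 (hi.2.trans (hmul h3))
    have ht : Tendsto (fun δ : ℝ => x + Pi.single k ((δ : 𝕜) • z)) (𝓝[>] 0) (𝓝 x) := by
      have : Continuous fun δ : ℝ => x + Pi.single k ((δ : 𝕜) • z) :=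
        continuous_const.add ((continuous_single k).comp
          (RCLike.continuous_ofReal.smul continuous_const))
      have h0 := this.tendsto 0
      simp only [RCLike.ofReal_zero, zero_smul, Pi.single_zero, add_zero] at h0
      exact h0.mono_left nhdsWithin_le_nhds
    refine isClosed_closure.mem_of_tendsto ht ?_
    filter_upwards [self_mem_nhdsWithin] with δ hδ using key δ hδ
  have hd₃ : ∀ U, Dense (O₃ U) := by
    intro U
    rw [dense_iff_inter_open]
    intro V hV ⟨x, hx⟩
    obtain ⟨u, hu⟩ := TopologicalSpace.nonempty_of_mem_countableBasis U.2
    have ht : Tendsto (fun l : ℕ => Function.update x l u) atTop (𝓝 x) := by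
      rw [tendsto_pi_nhds]
      intro i
      refine tendsto_const_nhds.congr' ?_
      filter_upwards [eventually_gt_atTop i] with l hl
      rw [Function.update_of_ne hl.ne]
    obtain ⟨l, hl⟩ := (ht.eventually (hV.mem_nhds hx)).exists
    exact ⟨_, hl, Set.mem_iUnion.2 ⟨l, by simpa using hu⟩⟩
  have hG : Dense ((⋂ M, O₁ M) ∩ (⋂ p, O₂ p) ∩ ⋂ U, O₃ U) :=
    ((dense_iInter_of_isOpen hO₁ hd₁).inter_of_Gδ (.iInter_of_isOpen hO₁) (.iInter_of_isOpen hO₂)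
      (dense_iInter_of_isOpen hO₂ hd₂)).inter_of_Gδ
      ((IsGδ.iInter_of_isOpen hO₁).inter (.iInter_of_isOpen hO₂)) (.iInter_of_isOpen hO₃)
      (dense_iInter_of_isOpen hO₃ hd₃)
  obtain ⟨x, ⟨hx₁, hx₂⟩, hx₃⟩ := hG.nonempty
  rw [Set.mem_iInter] at hx₁ hx₂ hx₃
  refine ⟨Submodule.span 𝕜 (Set.range x), ?_, fun y hy hy0 => ?_⟩
  · refine Dense.mono Submodule.subset_span ?_
    rw [(TopologicalSpace.isBasis_countableBasis X).dense_iff]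
    intro U hU _
    obtain ⟨l, hl⟩ := Set.mem_iUnion.1 (hx₃ ⟨U, hU⟩)
    exact ⟨x l, hl, l, rfl⟩
  · refine intervalIrregular_of_mem_span ?_ ?_ hy hy0
    · intro M
      have := hx₁ M
      simp only [O₁, Set.mem_iUnion, Set.mem_iInter] at this
      obtain ⟨N, hN, h⟩ := this
      exact ⟨N, hN.1, hN.2, fun i h1 h2 l hl => h i ⟨h1, h2⟩ l hl⟩
    · intro j M
      have := hx₂ (j, M)
      simp only [O₂, Set.mem_iUnion, Set.mem_iInter, Set.mem_inter_iff] at this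
      obtain ⟨N, hN, h⟩ := this
      exact ⟨N, hN.1, hN.2, fun i h1 h2 => ⟨(h i ⟨h1, h2⟩).1, fun l hl hlj =>
        (h i ⟨h1, h2⟩).2 l ⟨hl, hlj⟩⟩⟩

/-- Birkhoff's transitivity theorem. -/
theorem exists_dense_orbit_of_transitive [CompleteSpace X] [TopologicalSpace.SeparableSpace X]
    {T : X →L[𝕜] X} {D : Set X} (hD : Dense D)
    (h : ∀ x ∈ D, ∀ y ∈ D, ∀ ε > (0 : ℝ), ∃ v : X, ∃ n : ℕ, ‖v - x‖ < ε ∧ ‖(T ^ n) v - y‖ < ε) :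
    ∃ x : X, Dense (Set.range fun n : ℕ => (T ^ n) x) := by
  have : SecondCountableTopology X := UniformSpace.secondCountable_of_separable X
  let O : TopologicalSpace.countableBasis X → Set X := fun U => ⋃ n : ℕ, (T ^ n) ⁻¹' U.1
  have hopen : ∀ U, IsOpen (O U) := fun U => isOpen_iUnion fun n =>
    (TopologicalSpace.isOpen_of_mem_countableBasis U.2).preimage (T ^ n).continuous
  have hdense : ∀ U, Dense (O U) := by
    intro U
    rw [dense_iff_inter_open]
    intro V hV hVne
    obtain ⟨x, hxV, hxD⟩ := hD.inter_open_nonempty V hV hVne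
    obtain ⟨y, hyU, hyD⟩ := hD.inter_open_nonempty U.1
      (TopologicalSpace.isOpen_of_mem_countableBasis U.2)
      (TopologicalSpace.nonempty_of_mem_countableBasis U.2)
    obtain ⟨ε₁, hε₁, hb₁⟩ := Metric.isOpen_iff.1 hV x hxV
    obtain ⟨ε₂, hε₂, hb₂⟩ := Metric.isOpen_iff.1
      (TopologicalSpace.isOpen_of_mem_countableBasis U.2) y hyU
    obtain ⟨v, n, h1, h2⟩ := h x hxD y hyD (min ε₁ ε₂) (lt_min hε₁ hε₂)
    refine ⟨v, hb₁ ?_, Set.mem_iUnion.2 ⟨n, hb₂ ?_⟩⟩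
    · rw [Metric.mem_ball, dist_eq_norm]
      exact h1.trans_le (min_le_left _ _)
    · rw [Metric.mem_ball, dist_eq_norm]
      exact h2.trans_le (min_le_right _ _)
  obtain ⟨x, hx⟩ := (dense_iInter_of_isOpen hopen hdense).nonempty
  rw [Set.mem_iInter] at hx
  refine ⟨x, ?_⟩
  rw [(TopologicalSpace.isBasis_countableBasis X).dense_iff]
  intro U hU _
  obtain ⟨n, hn⟩ := Set.mem_iUnion.1 (hx ⟨U, hU⟩)
  exact ⟨(T ^ n) x, hn, n, rfl⟩

end Baire

section PolyNorm

open Polynomial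

variable {𝕜 : Type*} [RCLike 𝕜]

/-- The weighted `ℓ¹` norm `∑ ‖c_k‖ r ^ k` of a polynomial `∑ c_k X ^ k`. -/
noncomputable def polyNorm (r : ℝ) (p : 𝕜[X]) : ℝ := p.sum fun k c => ‖c‖ * r ^ k

theorem polyNorm_eq_sum_range (r : ℝ) {p : 𝕜[X]} {n : ℕ} (hn : p.natDegree < n) :
    polyNorm r p = ∑ k ∈ Finset.range n, ‖p.coeff k‖ * r ^ k :=
  p.sum_over_range' (by simp) n hn

theorem polyNorm_nonneg {r : ℝ} (hr : 0 ≤ r) (p : 𝕜[X]) : 0 ≤ polyNorm r p :=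
  Finset.sum_nonneg fun _ _ => by positivity

theorem polyNorm_zero (r : ℝ) : polyNorm r (0 : 𝕜[X]) = 0 := by simp [polyNorm]

theorem polyNorm_monomial (r : ℝ) (k : ℕ) (c : 𝕜) : polyNorm r (monomial k c) = ‖c‖ * r ^ k := by
  rw [polyNorm, sum_monomial_index _ _ (by simp)]

theorem polyNorm_one (r : ℝ) : polyNorm r (1 : 𝕜[X]) = 1 := by
  rw [← monomial_zero_one, polyNorm_monomial]; simp

theorem polyNorm_C (r : ℝ) (c : 𝕜) : polyNorm r (C c) = ‖c‖ := by
  rw [← monomial_zero_left, polyNorm_monomial]; simp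

theorem polyNorm_C_mul_X (r : ℝ) (c : 𝕜) : polyNorm r (C c * X) = ‖c‖ * r := by
  rw [C_mul_X_eq_monomial, polyNorm_monomial, pow_one]

theorem polyNorm_add_le {r : ℝ} (hr : 0 ≤ r) (p q : 𝕜[X]) :
    polyNorm r (p + q) ≤ polyNorm r p + polyNorm r q := by
  have h1 : p.natDegree < max p.natDegree q.natDegree + 1 := by omega
  have h2 : q.natDegree < max p.natDegree q.natDegree + 1 := by omega
  have h3 : (p + q).natDegree < max p.natDegree q.natDegree + 1 :=
    Nat.lt_succ_of_le (natDegree_add_le p q)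
  rw [polyNorm_eq_sum_range r h1, polyNorm_eq_sum_range r h2, polyNorm_eq_sum_range r h3,
    ← Finset.sum_add_distrib]
  refine Finset.sum_le_sum fun k _ => ?_
  rw [coeff_add, ← add_mul]
  gcongr
  exact norm_add_le _ _

theorem polyNorm_sum_le {r : ℝ} (hr : 0 ≤ r) {ι : Type*} (s : Finset ι) (p : ι → 𝕜[X]) :
    polyNorm r (∑ i ∈ s, p i) ≤ ∑ i ∈ s, polyNorm r (p i) :=
  Finset.le_sum_of_subadditive _ (polyNorm_zero r).le (polyNorm_add_le hr) _ _

theorem polyNorm_monomial_mul (r : ℝ) (k : ℕ) (c : 𝕜) (q : 𝕜[X]) :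
    polyNorm r (monomial k c * q) = ‖c‖ * r ^ k * polyNorm r q := by
  have h : (monomial k c * q).natDegree < k + (q.natDegree + 1) := by
    have := natDegree_mul_le (p := monomial k c) (q := q)
    have := natDegree_monomial_le c (m := k)
    omega
  rw [polyNorm_eq_sum_range r h, polyNorm_eq_sum_range r q.natDegree.lt_succ_self,
    Finset.sum_range_add, Finset.mul_sum, Finset.sum_eq_zero, zero_add]
  · refine Finset.sum_congr rfl fun i _ => ?_
    rw [add_comm k i, coeff_monomial_mul, norm_mul, pow_add]
    ring
  · intro i hi
    rw [← C_mul_X_pow_eq_monomial, mul_assoc, coeff_C_mul, coeff_X_pow_mul',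
      if_neg (not_le.2 (Finset.mem_range.1 hi))]
    simp

theorem polyNorm_mul_le {r : ℝ} (hr : 0 ≤ r) (p q : 𝕜[X]) :
    polyNorm r (p * q) ≤ polyNorm r p * polyNorm r q := by
  conv_lhs => rw [p.as_sum_range, Finset.sum_mul]
  refine (polyNorm_sum_le hr _ _).trans ?_
  rw [polyNorm_eq_sum_range r p.natDegree.lt_succ_self, Finset.sum_mul]
  exact Finset.sum_le_sum fun i _ => (polyNorm_monomial_mul r i _ q).le

theorem polyNorm_pow_le {r : ℝ} (hr : 0 ≤ r) (p : 𝕜[X]) (n : ℕ) :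
    polyNorm r (p ^ n) ≤ polyNorm r p ^ n := by
  induction n with
  | zero => simp [polyNorm_one]
  | succ n ih =>
    rw [pow_succ, pow_succ]
    exact (polyNorm_mul_le hr _ _).trans
      (mul_le_mul_of_nonneg_right ih (polyNorm_nonneg hr _))

theorem polyNorm_mono {r s : ℝ} (hr : 0 ≤ r) (hrs : r ≤ s) (p : 𝕜[X]) :
    polyNorm r p ≤ polyNorm s p :=
  Finset.sum_le_sum fun _ _ => by dsimp only; gcongr

theorem polyNorm_taylor_le {r : ℝ} (hr : 0 ≤ r) (a : 𝕜) (p : 𝕜[X]) :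
    polyNorm r (taylor a p) ≤ polyNorm (‖a‖ + r) p := by
  conv_lhs => rw [p.as_sum_range, map_sum]
  refine (polyNorm_sum_le hr _ _).trans ?_
  rw [polyNorm_eq_sum_range _ p.natDegree.lt_succ_self]
  refine Finset.sum_le_sum fun i _ => ?_
  rw [taylor_monomial]
  refine (polyNorm_mul_le hr _ _).trans ?_
  rw [polyNorm_C]
  refine mul_le_mul_of_nonneg_left ((polyNorm_pow_le hr _ _).trans ?_) (norm_nonneg _)
  refine pow_le_pow_left₀ (polyNorm_nonneg hr _) ((polyNorm_add_le hr _ _).trans ?_) _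
  have hX := polyNorm_C_mul_X r (1 : 𝕜)
  rw [C_1, one_mul, norm_one, one_mul] at hX
  rw [hX, polyNorm_C, add_comm]

theorem polyNorm_le_pow_mul {r : ℝ} (hr : 1 ≤ r) {p : 𝕜[X]} {d : ℕ} (hd : p.natDegree ≤ d) :
    polyNorm r p ≤ r ^ d * polyNorm 1 p := by
  rw [polyNorm_eq_sum_range r (Nat.lt_succ_of_le hd),
    polyNorm_eq_sum_range 1 (Nat.lt_succ_of_le hd), Finset.mul_sum]
  refine Finset.sum_le_sum fun k hk => ?_
  rw [one_pow, mul_one, mul_comm]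
  gcongr
  exact Nat.lt_succ_iff.1 (Finset.mem_range.1 hk)

theorem polyNorm_one_add_pow_sub_one_le {r : ℝ} (hr : 0 ≤ r) (u : 𝕜[X]) (n : ℕ) :
    polyNorm r ((1 + u) ^ n - 1) ≤ (1 + polyNorm r u) ^ n - 1 := by
  induction n with
  | zero => simp [polyNorm_zero]
  | succ n ih =>
    have h0 := polyNorm_nonneg hr u
    have h1 : (1 + u) ^ (n + 1) - 1 = ((1 + u) ^ n - 1) * (1 + u) + u := by ring
    have h2 : polyNorm r (1 + u) ≤ 1 + polyNorm r u := by
      simpa only [polyNorm_one] using polyNorm_add_le hr 1 u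
    rw [h1]
    calc polyNorm r (((1 + u) ^ n - 1) * (1 + u) + u)
        ≤ polyNorm r ((1 + u) ^ n - 1) * polyNorm r (1 + u) + polyNorm r u :=
          (polyNorm_add_le hr _ _).trans (by gcongr; exact polyNorm_mul_le hr _ _)
      _ ≤ ((1 + polyNorm r u) ^ n - 1) * (1 + polyNorm r u) + polyNorm r u := by
          gcongr
          · exact polyNorm_nonneg hr _
          · exact sub_nonneg.2 (one_le_pow₀ (by linarith))
      _ = _ := by ring

end PolyNorm

section Stage

open Polynomial

variable {𝕜 : Type*} [RCLike 𝕜]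

/-- The scale at which polynomials of degree at most `b` are measured. -/
def scale (b : ℕ) : ℕ := (b + 1) ^ 5

/-- The length of time attached to the consecutive degrees `a < b`. -/
def stageTime (a b : ℕ) : ℕ := scale b ^ (a + 3)

/-- A constant dominating the reciprocals of the weights up to `a`. -/
def weightConst (a : ℕ) : ℕ := (a + 1) ^ (4 * a)

/-- The numerical conditions saying that `b` is large enough with respect to `a`. -/
def IsStage (a b : ℕ) : Prop :=
  a < b ∧
  (weightConst a : ℝ) * ((scale b : ℝ) ^ a * a *
    ((1 + (scale b : ℝ) / stageTime a b) ^ (b - a) - 1)) ≤ 1 / ((a : ℝ) + 1) ∧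
  (weightConst a : ℝ) * ((stageTime a b + scale b : ℝ) ^ a * a *
    (1 - 1 / ((a : ℝ) + 1) + (scale b : ℝ) / stageTime a b) ^ (b - a)) ≤ 1 / ((a : ℝ) + 1)

theorem one_le_scale (b : ℕ) : (1 : ℝ) ≤ scale b := by
  exact_mod_cast Nat.one_le_pow _ _ b.succ_pos

theorem stageTime_pos (a b : ℕ) : (0 : ℝ) < stageTime a b := by
  rw [stageTime]
  push_cast
  have := one_le_scale b
  positivity

theorem le_scale (b : ℕ) : (b : ℝ) + 1 ≤ scale b := by
  rw [scale]
  exact_mod_cast Nat.le_self_pow (by norm_num) _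

theorem scale_le_stageTime (a b : ℕ) : (scale b : ℝ) ≤ stageTime a b := by
  rw [stageTime]
  rw [Nat.cast_pow]
  exact le_self_pow₀ (one_le_scale b) (by omega)

theorem scale_div_stageTime (a b : ℕ) :
    (scale b : ℝ) / stageTime a b = 1 / (scale b : ℝ) ^ (a + 2) := by
  have := one_le_scale b
  rw [stageTime, Nat.cast_pow, pow_succ (scale b : ℝ) (a + 2)]
  field_simp

theorem eventually_isStage (a : ℕ) : ∀ᶠ b in atTop, IsStage a b := by
  have ha : (0 : ℝ) < (a : ℝ) + 1 := by positivity
  refine (eventually_gt_atTop a).and (Eventually.and ?_ ?_)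
  · have hlim : Tendsto (fun b : ℕ => (weightConst a : ℝ) * a * 2 * (1 / ((b : ℝ) + 1))) atTop
        (𝓝 ((weightConst a : ℝ) * a * 2 * 0)) :=
      tendsto_one_div_add_atTop_nhds_zero_nat.const_mul _
    rw [mul_zero] at hlim
    filter_upwards [hlim.eventually_le_const (show (0 : ℝ) < 1 / ((a : ℝ) + 1) by positivity)]
      with b hb
    refine le_trans ?_ hb
    have hr := one_le_scale b
    have hr' := le_scale b
    set r : ℝ := (scale b : ℝ)
    have hb0 : (0 : ℝ) ≤ b := b.cast_nonneg
    have hx : r / stageTime a b = 1 / r ^ (a + 2) := scale_div_stageTime a b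
    rw [hx]
    have hbr : (b : ℝ) * (1 / r ^ (a + 2)) ≤ 1 := by
      rw [mul_one_div, div_le_one (by positivity)]
      calc (b : ℝ) ≤ r := by linarith
        _ ≤ r ^ (a + 2) := le_self_pow₀ hr (by omega)
    have hexp : (1 + 1 / r ^ (a + 2)) ^ (b - a) - 1 ≤ 2 * (b * (1 / r ^ (a + 2))) := by
      have h0 : 0 ≤ b * (1 / r ^ (a + 2)) := by positivity
      have h1 : (1 + 1 / r ^ (a + 2)) ^ (b - a) ≤ Real.exp (b * (1 / r ^ (a + 2))) := by
        rw [Real.exp_nat_mul]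
        calc (1 + 1 / r ^ (a + 2)) ^ (b - a) ≤ (1 + 1 / r ^ (a + 2)) ^ b := by
              gcongr
              · have : 0 ≤ 1 / r ^ (a + 2) := by positivity
                linarith
              · omega
          _ ≤ _ := by
              gcongr
              rw [add_comm]
              exact Real.add_one_le_exp _
      have h2 := Real.abs_exp_sub_one_le (x := b * (1 / r ^ (a + 2)))
        (by rw [abs_of_nonneg h0]; exact hbr)
      rw [abs_of_nonneg h0] at h2
      have h3 := le_abs_self (Real.exp (b * (1 / r ^ (a + 2))) - 1)
      linarith
    calc (weightConst a : ℝ) * (r ^ a * a * ((1 + 1 / r ^ (a + 2)) ^ (b - a) - 1))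
        ≤ weightConst a * (r ^ a * a * (2 * (b * (1 / r ^ (a + 2))))) := by gcongr
      _ = weightConst a * a * 2 * (b / r ^ 2) := by
          rw [pow_add]
          field_simp
      _ ≤ weightConst a * a * 2 * (1 / ((b : ℝ) + 1)) := by
          gcongr weightConst a * a * 2 * ?_
          rw [div_le_div_iff₀ (by positivity) (by positivity)]
          nlinarith
  · set ρ : ℝ := 1 - 1 / (2 * ((a : ℝ) + 1)) with hρ
    have hinv : 1 / (2 * ((a : ℝ) + 1)) ≤ 1 / 2 := by
      gcongr
      have : (0 : ℝ) ≤ a := a.cast_nonneg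
      linarith
    have hinv' : 0 < 1 / (2 * ((a : ℝ) + 1)) := by positivity
    have hρ0 : 0 < ρ := by linarith
    have hlim : Tendsto (fun b : ℕ => (weightConst a : ℝ) * (2 ^ a * a) / ρ ^ (a + 1) *
        (((b + 1 : ℕ) : ℝ) ^ (5 * (a + 3) * a) * ρ ^ (b + 1))) atTop
        (𝓝 ((weightConst a : ℝ) * (2 ^ a * a) / ρ ^ (a + 1) * 0)) :=
      (((tendsto_add_atTop_iff_nat 1).2 (tendsto_pow_const_mul_const_pow_of_abs_lt_one
        (5 * (a + 3) * a) (r := ρ) (by rw [abs_of_pos hρ0]; linarith)))).const_mul _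
    rw [mul_zero] at hlim
    filter_upwards [hlim.eventually_le_const (show (0 : ℝ) < 1 / ((a : ℝ) + 1) by positivity),
      eventually_ge_atTop (2 * (a + 1))] with b hb hab
    refine le_trans ?_ hb
    have hr := one_le_scale b
    have hr' := le_scale b
    have hx : (scale b : ℝ) / stageTime a b ≤ 1 / (2 * ((a : ℝ) + 1)) := by
      rw [scale_div_stageTime]
      have hab' : 2 * ((a : ℝ) + 1) ≤ b := by exact_mod_cast hab
      have : (scale b : ℝ) ≤ (scale b : ℝ) ^ (a + 2) := le_self_pow₀ hr (by omega)
      gcongr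
      linarith
    have hx0 : 0 ≤ (scale b : ℝ) / stageTime a b := by positivity
    have hρ' : 1 - 1 / ((a : ℝ) + 1) + (scale b : ℝ) / stageTime a b ≤ ρ := by
      have : 1 / ((a : ℝ) + 1) = 2 * (1 / (2 * ((a : ℝ) + 1))) := by field_simp
      linarith
    have hρ0' : 0 ≤ 1 - 1 / ((a : ℝ) + 1) + (scale b : ℝ) / stageTime a b := by
      have : 1 / ((a : ℝ) + 1) ≤ 1 := by
        rw [div_le_one ha]
        have : (0 : ℝ) ≤ a := a.cast_nonneg
        linarith
      linarith
    have hN : (stageTime a b + scale b : ℝ) ≤ 2 * (((b + 1 : ℕ) : ℝ) ^ (5 * (a + 3))) := by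
      have h1 := scale_le_stageTime a b
      have h2 : (stageTime a b : ℝ) = ((b + 1 : ℕ) : ℝ) ^ (5 * (a + 3)) := by
        rw [stageTime, scale]
        push_cast
        rw [← pow_mul]
      linarith
    calc (weightConst a : ℝ) * ((stageTime a b + scale b : ℝ) ^ a * a *
          (1 - 1 / ((a : ℝ) + 1) + (scale b : ℝ) / stageTime a b) ^ (b - a))
        ≤ weightConst a * ((2 * (((b + 1 : ℕ) : ℝ) ^ (5 * (a + 3)))) ^ a * a *
          ρ ^ (b - a)) := by gcongr
      _ = _ := by
          have : ρ ^ (b + 1) = ρ ^ (b - a) * ρ ^ (a + 1) := by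
            rw [← pow_add]
            congr 1
            omega
          rw [this, mul_pow, ← pow_mul]
          field_simp

/-- The polynomial `p` damped by a factor vanishing to high order at the stage time. -/
noncomputable def damp (a b : ℕ) (p : 𝕜[X]) : 𝕜[X] :=
  p * (1 + C (-(stageTime a b : 𝕜)⁻¹) * X) ^ (b - a)

theorem natDegree_one_add_C_mul_X_le (c : 𝕜) : (1 + C c * X).natDegree ≤ 1 := by
  compute_degree

theorem norm_inv_stageTime (a b : ℕ) : ‖(stageTime a b : 𝕜)⁻¹‖ = (stageTime a b : ℝ)⁻¹ := by
  rw [norm_inv, RCLike.norm_natCast]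

variable {a b : ℕ} {p : 𝕜[X]}

theorem natDegree_damp_le (hab : a ≤ b) (hp : p.natDegree ≤ a) : (damp a b p).natDegree ≤ b := by
  refine natDegree_mul_le.trans ?_
  have := natDegree_pow_le_of_le (b - a)
    (natDegree_one_add_C_mul_X_le (-(stageTime a b : 𝕜)⁻¹))
  omega

theorem IsStage.polyNorm_damp_sub_le_aux (h : IsStage a b) (hp : p.natDegree ≤ a)
    (hp1 : polyNorm 1 p ≤ a) {c : 𝕜} (hc : ‖c‖ = (stageTime a b : ℝ)⁻¹) :
    (weightConst a : ℝ) * polyNorm (scale b) (p * (1 + C c * X) ^ (b - a) - p) ≤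
      1 / ((a : ℝ) + 1) := by
  refine le_trans ?_ h.2.1
  have hr := one_le_scale b
  have hr0 : (0 : ℝ) ≤ scale b := zero_le_one.trans hr
  have hfac : p * (1 + C c * X) ^ (b - a) - p = p * ((1 + C c * X) ^ (b - a) - 1) := by ring
  have hu : polyNorm (scale b) (C c * X) = (scale b : ℝ) / stageTime a b := by
    rw [polyNorm_C_mul_X, hc, div_eq_mul_inv, mul_comm]
  rw [hfac]
  refine mul_le_mul_of_nonneg_left ((polyNorm_mul_le hr0 _ _).trans ?_) (Nat.cast_nonneg _)
  have h1 := polyNorm_one_add_pow_sub_one_le hr0 (C c * X) (b - a)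
  rw [hu] at h1
  have h2 : polyNorm (scale b) p ≤ (scale b : ℝ) ^ a * a :=
    (polyNorm_le_pow_mul hr hp).trans (by gcongr)
  exact mul_le_mul h2 h1 (polyNorm_nonneg hr0 _) (by positivity)

theorem IsStage.polyNorm_damp_sub_le (h : IsStage a b) (hp : p.natDegree ≤ a)
    (hp1 : polyNorm 1 p ≤ a) :
    (weightConst a : ℝ) * polyNorm (scale b) (damp a b p - p) ≤ 1 / ((a : ℝ) + 1) :=
  h.polyNorm_damp_sub_le_aux hp hp1 (by rw [norm_neg, norm_inv_stageTime])

theorem IsStage.polyNorm_mul_pow_le (h : IsStage a b) {t u : 𝕜[X]}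
    (ht : polyNorm (scale b) t ≤ (stageTime a b + scale b : ℝ) ^ a * a)
    (hu : polyNorm (scale b) u ≤ 1 - 1 / ((a : ℝ) + 1) + (scale b : ℝ) / stageTime a b) :
    (weightConst a : ℝ) * polyNorm (scale b) (t * u ^ (b - a)) ≤ 1 / ((a : ℝ) + 1) := by
  refine le_trans ?_ h.2.2
  have hr0 : (0 : ℝ) ≤ scale b := Nat.cast_nonneg _
  refine mul_le_mul_of_nonneg_left ((polyNorm_mul_le hr0 _ _).trans ?_) (Nat.cast_nonneg _)
  exact mul_le_mul ht ((polyNorm_pow_le hr0 _ _).trans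
    (pow_le_pow_left₀ (polyNorm_nonneg hr0 _) hu _)) (polyNorm_nonneg hr0 _) (by positivity)

theorem polyNorm_taylor_le_stageTime (hp : p.natDegree ≤ a) (hp1 : polyNorm 1 p ≤ a) {c : 𝕜}
    (hc : ‖c‖ ≤ stageTime a b) :
    polyNorm (scale b) (taylor c p) ≤ (stageTime a b + scale b : ℝ) ^ a * a := by
  have hr := one_le_scale b
  have hr0 : (0 : ℝ) ≤ scale b := zero_le_one.trans hr
  have hN := (stageTime_pos a b).le
  calc polyNorm (scale b) (taylor c p) ≤ polyNorm (‖c‖ + scale b) p := polyNorm_taylor_le hr0 c p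
    _ ≤ polyNorm (stageTime a b + scale b) p := by
        apply polyNorm_mono (by positivity)
        gcongr
    _ ≤ (stageTime a b + scale b : ℝ) ^ a * polyNorm 1 p :=
        polyNorm_le_pow_mul (by linarith) hp
    _ ≤ _ := by gcongr

theorem IsStage.polyNorm_taylor_damp_le (h : IsStage a b) (hp : p.natDegree ≤ a)
    (hp1 : polyNorm 1 p ≤ a) {n : ℕ} (hn : n ≤ stageTime a b) (hn' : stageTime a b ≤ (a + 1) * n) :
    (weightConst a : ℝ) * polyNorm (scale b) (taylor (n : 𝕜) (damp a b p)) ≤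
      1 / ((a : ℝ) + 1) := by
  have hN := stageTime_pos a b
  have hr0 : (0 : ℝ) ≤ scale b := Nat.cast_nonneg _
  have hnN : (n : ℝ) ≤ stageTime a b := by exact_mod_cast hn
  rw [damp, taylor_mul, taylor_pow]
  refine h.polyNorm_mul_pow_le (polyNorm_taylor_le_stageTime hp hp1 ?_) ?_
  · rwa [RCLike.norm_natCast]
  · have ht : taylor (n : 𝕜) (1 + C (-(stageTime a b : 𝕜)⁻¹) * X) =
        C (((1 - n / stageTime a b : ℝ) : 𝕜)) + C (-(stageTime a b : 𝕜)⁻¹) * X := by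
      have hcast : (((1 - n / stageTime a b : ℝ) : 𝕜)) = 1 - n * (stageTime a b : 𝕜)⁻¹ := by
        rw [← div_eq_mul_inv]
        push_cast
        rfl
      rw [hcast]
      simp only [map_add, taylor_one, taylor_mul, taylor_C, taylor_X, map_sub, C_1, map_neg, C_mul]
      ring
    rw [ht]
    refine (polyNorm_add_le hr0 _ _).trans ?_
    have h1 : (n : ℝ) / stageTime a b ≤ 1 := (div_le_one hN).2 hnN
    have h2 : 1 / ((a : ℝ) + 1) ≤ n / stageTime a b := by
      rw [div_le_div_iff₀ (by positivity) hN, one_mul, mul_comm]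
      exact_mod_cast hn'
    rw [polyNorm_C, polyNorm_C_mul_X, norm_neg, norm_inv_stageTime, RCLike.norm_ofReal,
      abs_of_nonneg (by linarith), inv_mul_eq_div]
    linarith

theorem IsStage.exists_taylor_sub_le (h : IsStage a b) (hp : p.natDegree ≤ a)
    (hp1 : polyNorm 1 p ≤ a) :
    ∃ v : 𝕜[X], v.natDegree ≤ b ∧
      (weightConst a : ℝ) * polyNorm (scale b) v ≤ 1 / ((a : ℝ) + 1) ∧
      (weightConst a : ℝ) * polyNorm (scale b) (taylor (stageTime a b : 𝕜) v - p) ≤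
        1 / ((a : ℝ) + 1) := by
  have hN := stageTime_pos a b
  have hN0 : (stageTime a b : 𝕜) ≠ 0 := by
    have : stageTime a b ≠ 0 := by exact_mod_cast hN.ne'
    exact_mod_cast this
  have hr0 : (0 : ℝ) ≤ scale b := Nat.cast_nonneg _
  refine ⟨taylor (-(stageTime a b : 𝕜)) p * (C (stageTime a b : 𝕜)⁻¹ * X) ^ (b - a), ?_, ?_, ?_⟩
  · refine natDegree_mul_le.trans ?_
    rw [natDegree_taylor]
    have := natDegree_pow_le_of_le (b - a)
      ((natDegree_C_mul_le (stageTime a b : 𝕜)⁻¹ X).trans natDegree_X_le)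
    have := h.1
    omega
  · refine h.polyNorm_mul_pow_le (polyNorm_taylor_le_stageTime hp hp1 ?_) ?_
    · rw [norm_neg, RCLike.norm_natCast]
    · rw [polyNorm_C_mul_X, norm_inv_stageTime, inv_mul_eq_div]
      have : 1 / ((a : ℝ) + 1) ≤ 1 := by
        rw [div_le_one (by positivity)]
        have : (0 : ℝ) ≤ a := a.cast_nonneg
        linarith
      linarith
  · have ht : taylor (stageTime a b : 𝕜) (taylor (-(stageTime a b : 𝕜)) p *
        (C (stageTime a b : 𝕜)⁻¹ * X) ^ (b - a)) =
        p * (1 + C (stageTime a b : 𝕜)⁻¹ * X) ^ (b - a) := by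
      rw [taylor_mul, taylor_pow, taylor_taylor, add_neg_cancel, taylor_zero, taylor_mul,
        taylor_C, taylor_X, mul_add, ← C_mul, inv_mul_cancel₀ hN0, C_1, add_comm]
    rw [ht]
    exact h.polyNorm_damp_sub_le_aux hp hp1 (norm_inv_stageTime a b)

end Stage

section Biorthogonal

variable {𝕜 : Type*} [RCLike 𝕜] {X : Type*} [NormedAddCommGroup X] [NormedSpace 𝕜 X]

/-- **Auerbach's lemma**: a finite-dimensional normed space has a basis of vectors of norm at
most one whose coordinate functionals have norm at most one. -/
theorem exists_auerbach_basis (G : Type*) [NormedAddCommGroup G] [NormedSpace 𝕜 G]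
    [FiniteDimensional 𝕜 G] :
    ∃ (v : Fin (Module.finrank 𝕜 G) → G) (g : Fin (Module.finrank 𝕜 G) → StrongDual 𝕜 G),
      (∀ i, ‖v i‖ ≤ 1) ∧ (∀ i, ‖g i‖ ≤ 1) ∧ (∀ i j, g i (v j) = if i = j then 1 else 0) ∧
      Submodule.span 𝕜 (Set.range v) = ⊤ := by
  set L := Module.finrank 𝕜 G
  have : ProperSpace G := FiniteDimensional.proper 𝕜 G
  let B : Module.Basis (Fin L) 𝕜 G := Module.finBasis 𝕜 G
  have hcont : Continuous fun v : Fin L → G => B.det v := by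
    simp only [Module.Basis.det_apply]
    refine Continuous.matrix_det (continuous_matrix fun i j => ?_)
    simp only [Module.Basis.toMatrix_apply]
    exact (B.coord i).continuous_of_finiteDimensional.comp (continuous_apply j)
  obtain ⟨v, hv, hmax⟩ := (isCompact_closedBall (0 : Fin L → G) 1).exists_isMaxOn
    ⟨0, by simp⟩ hcont.norm.continuousOn
  have hball : ∀ w : Fin L → G, (∀ i, ‖w i‖ ≤ 1) → ‖B.det w‖ ≤ ‖B.det v‖ := fun w hw =>
    hmax (by simpa [pi_norm_le_iff_of_nonneg] using hw)
  have hv1 : ∀ i, ‖v i‖ ≤ 1 := by simpa [pi_norm_le_iff_of_nonneg] using hv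
  have hD : B.det v ≠ 0 := by
    have h1 := hball (fun i => ((‖B i‖⁻¹ : ℝ) : 𝕜) • B i) fun i => by
      rw [norm_smul, RCLike.norm_ofReal, abs_of_nonneg (by positivity)]
      exact inv_mul_le_one
    intro h0
    rw [B.det.map_smul_univ, B.det_self, h0, norm_zero, norm_le_zero_iff, smul_eq_mul, mul_one,
      Finset.prod_eq_zero_iff] at h1
    obtain ⟨i, -, hi⟩ := h1
    have := B.ne_zero i
    simp_all
  have hbound : ∀ i x, ‖(B.det v)⁻¹ * B.det (Function.update v i x)‖ ≤ 1 * ‖x‖ := by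
    intro i x
    rcases eq_or_ne x 0 with rfl | hx
    · simp [B.det.map_update_zero]
    have hx' : (0 : ℝ) < ‖x‖ := norm_pos_iff.2 hx
    have h1 := hball (Function.update v i (((‖x‖⁻¹ : ℝ) : 𝕜) • x)) fun j => by
      rcases eq_or_ne j i with rfl | hj
      · rw [Function.update_self, norm_smul, RCLike.norm_ofReal, abs_of_nonneg (by positivity)]
        exact inv_mul_le_one
      · rw [Function.update_of_ne hj]
        exact hv1 j
    rw [B.det.map_update_smul, norm_smul, RCLike.norm_ofReal, abs_of_nonneg (by positivity),
      inv_mul_le_iff₀ hx'] at h1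
    rw [norm_mul, norm_inv, inv_mul_le_iff₀ (norm_pos_iff.2 hD)]
    linarith
  refine ⟨v, fun i => LinearMap.mkContinuous
    ((B.det v)⁻¹ • B.det.toMultilinearMap.toLinearMap v i) 1 (hbound i), hv1,
    fun i => LinearMap.mkContinuous_norm_le _ zero_le_one _, fun i j => ?_, ?_⟩
  · change (B.det v)⁻¹ * B.det (Function.update v i (v j)) = _
    split_ifs with hij
    · rw [← hij, Function.update_eq_self, inv_mul_cancel₀ hD]
    · rw [B.det.map_update_self v hij, mul_zero]
  · exact ((Module.Basis.is_basis_iff_det B).2 (isUnit_iff_ne_zero.2 hD)).2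

theorem exists_auerbach_system (G : Submodule 𝕜 X) [FiniteDimensional 𝕜 G] :
    ∃ (v : ℕ → X) (g : ℕ → StrongDual 𝕜 X),
      (∀ i < Module.finrank 𝕜 G, v i ∈ G ∧ ‖v i‖ ≤ 1 ∧ ‖g i‖ ≤ 1 ∧
        ∀ j < Module.finrank 𝕜 G, g i (v j) = if i = j then 1 else 0) ∧
      G ≤ Submodule.span 𝕜 (v '' Set.Iio (Module.finrank 𝕜 G)) := by
  obtain ⟨v, g, hv, hg, hgv, hspan⟩ := exists_auerbach_basis (𝕜 := 𝕜) G
  choose g' hg' hg'n using fun i => exists_extension_norm_eq G (g i)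
  refine ⟨fun i => if h : i < Module.finrank 𝕜 G then v ⟨i, h⟩ else 0,
    fun i => if h : i < Module.finrank 𝕜 G then g' ⟨i, h⟩ else 0, fun i hi => ?_, ?_⟩
  · simp only [hi, dif_pos]
    refine ⟨(v ⟨i, hi⟩).2, hv _, (hg'n _).trans_le (hg _), fun j hj => ?_⟩
    simp only [hj, dif_pos]
    rw [hg', hgv]
    simp [Fin.ext_iff]
  · have h1 : G = (Submodule.span 𝕜 (Set.range v)).map G.subtype := by
      rw [hspan, Submodule.map_subtype_top]
    rw [Submodule.map_span] at h1
    refine h1.le.trans (Submodule.span_mono ?_)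
    rintro _ ⟨_, ⟨i, rfl⟩, rfl⟩
    exact ⟨i, i.2, by simp⟩

/-- The first `n` terms of `e` have norm at most one and are biorthogonal to those of `f`. -/
def IsBiorthogonalUpTo (n : ℕ) (e : ℕ → X) (f : ℕ → StrongDual 𝕜 X) : Prop :=
  ∀ i < n, ‖e i‖ ≤ 1 ∧ ∀ j < n, f i (e j) = if i = j then 1 else 0

theorem exists_finiteDimensional_submodule_le (V : Submodule 𝕜 X) (hV : ¬ FiniteDimensional 𝕜 V)
    (L : ℕ) : ∃ G ≤ V, FiniteDimensional 𝕜 G ∧ L ≤ Module.finrank 𝕜 G := by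
  have hrank : (L : Cardinal) ≤ Module.rank 𝕜 V := by
    refine Cardinal.natCast_le_aleph0.trans (not_lt.1 fun h => hV ?_)
    exact Module.rank_lt_aleph0_iff.1 h
  obtain ⟨s, hs, hli⟩ := exists_finset_linearIndependent_of_le_rank hrank
  refine ⟨(Submodule.span 𝕜 (s : Set V)).map V.subtype, Submodule.map_subtype_le _ _, ?_, ?_⟩
  · have : FiniteDimensional 𝕜 (Submodule.span 𝕜 (s : Set V)) :=
      FiniteDimensional.span_finset 𝕜 s
    infer_instance
  · rw [(Submodule.equivMapOfInjective V.subtype V.injective_subtype _).symm.finrank_eq,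
      finrank_span_finset_eq_card hli, hs]

theorem IsBiorthogonalUpTo.exists_extension (hX : ¬ FiniteDimensional 𝕜 X) {n : ℕ} {e : ℕ → X}
    {f : ℕ → StrongDual 𝕜 X} (h : IsBiorthogonalUpTo n e f) (x : X) :
    ∃ (n' : ℕ) (e' : ℕ → X) (f' : ℕ → StrongDual 𝕜 X), IsBiorthogonalUpTo n' e' f' ∧ n < n' ∧
      (∀ i < n, e' i = e i ∧ f' i = f i) ∧ x ∈ Submodule.span 𝕜 (e' '' Set.Iio n') ∧
      ∀ i < n', ‖f' i‖ ≤ n' := by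
  let F : X →ₗ[𝕜] (Fin n → 𝕜) := LinearMap.pi fun i => (f i : X →ₗ[𝕜] 𝕜)
  have hF : ∀ y, y ∈ LinearMap.ker F ↔ ∀ i < n, f i y = 0 := by
    intro y
    rw [LinearMap.mem_ker, funext_iff]
    exact ⟨fun h i hi => h ⟨i, hi⟩, fun h i => h i i.2⟩
  have hker : ¬ FiniteDimensional 𝕜 (LinearMap.ker F) := fun hfin => hX <| by
    refine Module.finite_def.2 (Submodule.fg_of_fg_map_of_fg_inf_ker F ?_ ?_)
    · exact IsNoetherian.noetherian _
    · rw [top_inf_eq]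
      exact (Submodule.fg_top _).1 (Module.finite_def.1 hfin)
  set S : ℝ := ∑ j ∈ Finset.range n, ‖f j‖ with hS
  have hS0 : 0 ≤ S := Finset.sum_nonneg fun _ _ => norm_nonneg _
  obtain ⟨G₀, hG₀, hfin₀, hL⟩ := exists_finiteDimensional_submodule_le _ hker ⌈1 + S⌉₊
  set x' : X := x - ∑ j ∈ Finset.range n, f j x • e j with hx'
  have hx'F : x' ∈ LinearMap.ker F := by
    rw [hF]
    intro i hi
    rw [hx', map_sub, map_sum]
    rw [Finset.sum_congr rfl fun j hj => by
      rw [map_smul, (h i hi).2 j (Finset.mem_range.1 hj), smul_eq_mul, mul_ite, mul_one, mul_zero]]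
    simp [hi]
  set G : Submodule 𝕜 X := G₀ ⊔ Submodule.span 𝕜 {x'}
  have hGF : ∀ y ∈ G, ∀ i < n, f i y = 0 := by
    have : G ≤ LinearMap.ker F := sup_le hG₀ ((Submodule.span_singleton_le_iff_mem _ _).2 hx'F)
    exact fun y hy => (hF y).1 (this hy)
  set M := Module.finrank 𝕜 G
  have hM : 1 + S ≤ M := (Nat.le_ceil _).trans
    (by exact_mod_cast hL.trans (Submodule.finrank_mono le_sup_left))
  have hM0 : 0 < M := by
    have : (0 : ℝ) < M := by linarith
    exact_mod_cast this
  obtain ⟨v, g, hvg, hspan⟩ := exists_auerbach_system G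
  refine ⟨n + M, fun i => if i < n then e i else v (i - n),
    fun i => if i < n then f i else g (i - n) - ∑ j ∈ Finset.range n, g (i - n) (e j) • f j,
    fun i hi => ⟨?_, fun j hj => ?_⟩, by omega, fun i hi => by simp [hi], ?_, fun i hi => ?_⟩
  · dsimp only
    split_ifs with hin
    · exact (h i hin).1
    · exact (hvg (i - n) (by omega)).2.1
  · dsimp only
    rcases lt_or_ge i n with hin | hin <;> rcases lt_or_ge j n with hjn | hjn
    · simp only [hin, hjn, if_true]
      exact (h i hin).2 j hjn
    · simp only [hin, hjn.not_gt, if_true, if_false]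
      rw [if_neg (by omega)]
      exact hGF _ (hvg (j - n) (by omega)).1 i hin
    · simp only [hjn, hin.not_gt, if_true, if_false]
      rw [if_neg (by omega)]
      simp only [sub_apply, sum_apply,
        smul_apply]
      rw [Finset.sum_congr rfl fun k hk => by
        rw [(h k (Finset.mem_range.1 hk)).2 j hjn, smul_eq_mul, mul_ite, mul_one, mul_zero]]
      simp [hjn]
    · simp only [hin.not_gt, hjn.not_gt, if_false]
      simp only [sub_apply, sum_apply,
        smul_apply]
      rw [Finset.sum_eq_zero fun k hk => by
        rw [hGF _ (hvg (j - n) (by omega)).1 k (Finset.mem_range.1 hk), smul_zero],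
        (hvg (i - n) (by omega)).2.2.2 (j - n) (by omega), sub_zero]
      congr 1
      exact propext ⟨fun _ => by omega, fun _ => by omega⟩
  · have hxx : x = x' + ∑ j ∈ Finset.range n, f j x • e j := by rw [hx']; abel
    rw [hxx]
    refine add_mem ?_ (Submodule.sum_mem _ fun j hj => Submodule.smul_mem _ _ ?_)
    · have hx'G : x' ∈ G := Submodule.mem_sup_right (Submodule.mem_span_singleton_self _)
      refine Submodule.span_mono ?_ (hspan hx'G)
      rintro _ ⟨i, hi, rfl⟩
      exact ⟨n + i, Nat.add_lt_add_left hi n, by simp⟩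
    · have hj := Finset.mem_range.1 hj
      exact Submodule.subset_span ⟨j, hj.trans_le (by omega), by simp [hj]⟩
  · dsimp only
    push_cast
    have hn0 : (0 : ℝ) ≤ n := n.cast_nonneg
    split_ifs with hin
    · have : ‖f i‖ ≤ S := Finset.single_le_sum (f := fun j => ‖f j‖)
        (fun _ _ => norm_nonneg _) (Finset.mem_range.2 hin)
      linarith
    · have hg1 := (hvg (i - n) (by omega)).2.2.1
      have : ‖∑ j ∈ Finset.range n, g (i - n) (e j) • f j‖ ≤ S := by
        refine norm_sum_le_of_le _ fun j hj => ?_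
        rw [norm_smul]
        have h1 : ‖g (i - n) (e j)‖ ≤ 1 * 1 := (ContinuousLinearMap.le_opNorm _ _).trans
          (mul_le_mul hg1 (h j (Finset.mem_range.1 hj)).1 (norm_nonneg _) zero_le_one)
        calc _ ≤ (1 * 1) * ‖f j‖ := by gcongr
          _ = ‖f j‖ := by ring
      have := norm_sub_le (g (i - n)) (∑ j ∈ Finset.range n, g (i - n) (e j) • f j)
      linarith

/-- Every infinite-dimensional separable normed space has a fundamental biorthogonal sequence,
normalized in such a way that infinitely many initial blocks of the functionals are bounded by
their length. -/
theorem exists_biorthogonal_sequence [TopologicalSpace.SeparableSpace X]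
    (hX : ¬ FiniteDimensional 𝕜 X) :
    ∃ (e : ℕ → X) (f : ℕ → StrongDual 𝕜 X), (∀ i, ‖e i‖ ≤ 1) ∧
      (∀ i j, f i (e j) = if i = j then 1 else 0) ∧
      Dense (Submodule.span 𝕜 (Set.range e) : Set X) ∧
      ∀ n, ∃ b ≥ n, ∀ k ≤ b, ‖f k‖ ≤ (b : ℝ) + 1 := by
  let St := {s : ℕ × (ℕ → X) × (ℕ → StrongDual 𝕜 X) // IsBiorthogonalUpTo s.1 s.2.1 s.2.2}
  have hstep : ∀ (x : X) (s : St), ∃ t : St, s.1.1 < t.1.1 ∧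
      (∀ i < s.1.1, t.1.2.1 i = s.1.2.1 i ∧ t.1.2.2 i = s.1.2.2 i) ∧
      x ∈ Submodule.span 𝕜 (t.1.2.1 '' Set.Iio t.1.1) ∧ ∀ i < t.1.1, ‖t.1.2.2 i‖ ≤ t.1.1 := by
    intro x s
    obtain ⟨n', e', f', h1, h2, h3, h4, h5⟩ := s.2.exists_extension hX x
    exact ⟨⟨(n', e', f'), h1⟩, h2, h3, h4, h5⟩
  choose next hlt hagree hmem hnorm using hstep
  let s : ℕ → St := fun k => Nat.rec ⟨(0, 0, 0), fun i hi => absurd hi (Nat.not_lt_zero i)⟩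
    (fun k t => next (TopologicalSpace.denseSeq X k) t) k
  have hs : ∀ k, s (k + 1) = next (TopologicalSpace.denseSeq X k) (s k) := fun _ => rfl
  have hmono : StrictMono fun k => (s k).1.1 := strictMono_nat_of_lt_succ fun k => by
    rw [hs]
    exact hlt _ _
  have hag : ∀ k m, k ≤ m → ∀ i < (s k).1.1,
      (s m).1.2.1 i = (s k).1.2.1 i ∧ (s m).1.2.2 i = (s k).1.2.2 i := by
    intro k m hkm i hi
    induction m, hkm using Nat.le_induction with
    | base => exact ⟨rfl, rfl⟩
    | succ m hkm ih =>
      have := hagree (TopologicalSpace.denseSeq X m) (s m) i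
        (hi.trans_le (hmono.monotone hkm))
      rw [hs, this.1, this.2]
      exact ih
  have hself : ∀ i, i < (s (i + 1)).1.1 := fun i => hmono.le_apply (x := i + 1)
  have hag' : ∀ k, ∀ i < (s k).1.1,
      (s (i + 1)).1.2.1 i = (s k).1.2.1 i ∧ (s (i + 1)).1.2.2 i = (s k).1.2.2 i := by
    intro k i hi
    rcases le_total k (i + 1) with hk | hk
    · exact hag _ _ hk i hi
    · have := hag _ _ hk i (hself i)
      exact ⟨this.1.symm, this.2.symm⟩
  refine ⟨fun i => (s (i + 1)).1.2.1 i, fun i => (s (i + 1)).1.2.2 i,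
    fun i => ((s (i + 1)).2 i (hself i)).1, fun i j => ?_, ?_, fun n => ?_⟩
  · have hi : i < (s (max i j + 1)).1.1 := (le_max_left i j).trans_lt (hself _)
    have hj : j < (s (max i j + 1)).1.1 := (le_max_right i j).trans_lt (hself _)
    dsimp only
    rw [(hag' (max i j + 1) i hi).2, (hag' (max i j + 1) j hj).1]
    exact ((s (max i j + 1)).2 i hi).2 j hj
  · refine (TopologicalSpace.denseRange_denseSeq X).mono ?_
    rintro _ ⟨k, rfl⟩
    have := hmem (TopologicalSpace.denseSeq X k) (s k)
    rw [← hs] at this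
    refine Submodule.span_mono ?_ this
    rintro _ ⟨i, hi, rfl⟩
    exact ⟨i, (hag' (k + 1) i hi).1⟩
  · have hn := hself n
    refine ⟨(s (n + 1)).1.1 - 1, by omega, fun k hk => ?_⟩
    have hk' : k < (s (n + 1)).1.1 := by omega
    dsimp only
    rw [(hag' (n + 1) k hk').2]
    have := hnorm (TopologicalSpace.denseSeq X n) (s n) k (by rw [← hs]; exact hk')
    rw [← hs] at this
    rw [Nat.cast_sub (by omega)]
    push_cast
    linarith

end Biorthogonal

section WeightedMap

open Polynomial
open scoped Nat

variable {𝕜 : Type*} [RCLike 𝕜] {X : Type*} [NormedAddCommGroup X] [NormedSpace 𝕜 X]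

/-- The linear map from polynomials sending `W k / k! • X ^ k` to `e k`. -/
noncomputable def weightedMap (e : ℕ → X) (W : ℕ → ℝ) : 𝕜[X] →ₗ[𝕜] X :=
  Polynomial.lsum fun k => LinearMap.toSpanSingleton 𝕜 X (((k ! / W k : ℝ) : 𝕜) • e k)

variable {e : ℕ → X} {W : ℕ → ℝ}

theorem weightedMap_apply (p : 𝕜[X]) :
    weightedMap e W p = p.sum fun k c => (c * ((k ! / W k : ℝ) : 𝕜)) • e k := by
  simp [weightedMap, Polynomial.lsum_apply, mul_smul]

theorem weightedMap_monomial (n : ℕ) (c : 𝕜) :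
    weightedMap e W (monomial n c) = (c * ((n ! / W n : ℝ) : 𝕜)) • e n := by
  rw [weightedMap_apply, sum_monomial_index _ _ (by simp)]

theorem norm_weightedMap_le (he : ∀ i, ‖e i‖ ≤ 1) (hW : ∀ k, 0 < W k) {A r : ℝ} {b : ℕ}
    (hAr : ∀ k ≤ b, k ! / W k ≤ A * r ^ k) {p : 𝕜[X]} (hp : p.natDegree ≤ b) :
    ‖weightedMap e W p‖ ≤ A * polyNorm r p := by
  rw [weightedMap_apply, polyNorm, Polynomial.sum, Polynomial.sum, Finset.mul_sum]
  refine norm_sum_le_of_le _ fun k hk => ?_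
  have hk' : k ≤ b := (le_natDegree_of_mem_supp k hk).trans hp
  have h0 : 0 ≤ (k ! : ℝ) / W k := div_nonneg (Nat.cast_nonneg _) (hW k).le
  rw [norm_smul, norm_mul, RCLike.norm_ofReal, abs_of_nonneg h0]
  calc ‖p.coeff k‖ * (k ! / W k) * ‖e k‖ ≤ ‖p.coeff k‖ * (k ! / W k) * 1 := by
        gcongr
        exact he k
    _ ≤ ‖p.coeff k‖ * (A * r ^ k) := by
        rw [mul_one]
        gcongr
        exact hAr k hk'
    _ = A * (‖p.coeff k‖ * r ^ k) := by ring

/-- The preimage of `e n` under `weightedMap e W`. -/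
noncomputable def weightedMonomial (𝕜 : Type*) [RCLike 𝕜] (W : ℕ → ℝ) (n : ℕ) : 𝕜[X] :=
  monomial n ((W n / n ! : ℝ) : 𝕜)

theorem weightedMap_weightedMonomial (hW : ∀ k, 0 < W k) (n : ℕ) :
    weightedMap e W (weightedMonomial 𝕜 W n) = e n := by
  rw [weightedMonomial, weightedMap_monomial, ← RCLike.ofReal_mul]
  have h1 := (hW n).ne'
  have h2 : (n ! : ℝ) ≠ 0 := by exact_mod_cast n.factorial_ne_zero
  rw [div_mul_div_cancel₀ h2, div_self h1, RCLike.ofReal_one, one_smul]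

/-- The increment of `weightedMonomial 𝕜 W n` under translation, mapped to `X`. -/
noncomputable def weightedIncrement (𝕜 : Type*) [RCLike 𝕜] [NormedSpace 𝕜 X] (e : ℕ → X)
    (W : ℕ → ℝ) (n : ℕ) : X :=
  weightedMap e W (taylor (1 : 𝕜) (weightedMonomial 𝕜 W n) - weightedMonomial 𝕜 W n)

theorem norm_weightedIncrement_le (he : ∀ i, ‖e i‖ ≤ 1) (hW : ∀ k, 0 < W k) {n : ℕ} {w : ℝ}
    (hw : ∀ k < n, W n ≤ w * W k) : ‖weightedIncrement 𝕜 e W n‖ ≤ n * w := by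
  have hexp : taylor (1 : 𝕜) (weightedMonomial 𝕜 W n) - weightedMonomial 𝕜 W n =
      ∑ k ∈ Finset.range n, monomial k (((W n / n ! : ℝ) : 𝕜) * (n.choose k : 𝕜)) := by
    rw [weightedMonomial, taylor_monomial, add_pow, Finset.sum_range_succ, mul_add]
    simp only [C_1, one_pow, mul_one, Nat.sub_self, pow_zero, Nat.choose_self, Nat.cast_one]
    rw [C_mul_X_pow_eq_monomial, add_sub_cancel_right, Finset.mul_sum]
    refine Finset.sum_congr rfl fun k _ => ?_
    rw [← C_mul_X_pow_eq_monomial, C_mul, ← C_eq_natCast]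
    ring
  rw [weightedIncrement, hexp, map_sum]
  have hle : ∀ k ∈ Finset.range n,
      ‖weightedMap e W (monomial k (((W n / n ! : ℝ) : 𝕜) * (n.choose k : 𝕜)))‖ ≤ w := by
    intro k hk
    have hk := Finset.mem_range.1 hk
    have hn0 : (0 : ℝ) < n ! := by exact_mod_cast n.factorial_pos
    have hc : (n.choose k : ℝ) * k ! ≤ n ! := by
      have h1 := Nat.choose_mul_factorial_mul_factorial hk.le
      have h2 : n.choose k * k ! ≤ n ! := by
        rw [← h1]
        exact Nat.le_mul_of_pos_right _ (Nat.factorial_pos _)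
      exact_mod_cast h2
    rw [weightedMap_monomial, norm_smul, norm_mul, norm_mul, RCLike.norm_ofReal,
      RCLike.norm_ofReal, RCLike.norm_natCast,
      abs_of_nonneg (div_nonneg (hW n).le (Nat.cast_nonneg _)),
      abs_of_nonneg (div_nonneg (Nat.cast_nonneg _) (hW k).le)]
    have h0 : 0 ≤ W n / n ! * (n.choose k : ℝ) * (k ! / W k) :=
      mul_nonneg (mul_nonneg (div_nonneg (hW n).le hn0.le) (Nat.cast_nonneg _))
        (div_nonneg (Nat.cast_nonneg _) (hW k).le)
    calc W n / n ! * (n.choose k : ℝ) * (k ! / W k) * ‖e k‖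
        ≤ W n / n ! * (n.choose k : ℝ) * (k ! / W k) * 1 :=
          mul_le_mul_of_nonneg_left (he k) h0
      _ = W n / W k * (((n.choose k : ℝ) * k !) / n !) := by
          field_simp
      _ ≤ W n / W k * 1 := by
          have := hW n
          have := hW k
          gcongr
          rw [div_le_one hn0]
          exact hc
      _ ≤ w := by
          rw [mul_one, div_le_iff₀ (hW k)]
          exact hw k hk
  calc _ ≤ ∑ k ∈ Finset.range n, w := norm_sum_le_of_le _ hle
    _ = n * w := by simp

/-- Translation of polynomials induces a bounded operator as soon as the increments are small. -/
theorem exists_operator_weightedMap [CompleteSpace X] {f : ℕ → StrongDual 𝕜 X}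
    (hfe : ∀ i j, f i (e j) = if i = j then 1 else 0) (hW : ∀ k, 0 < W k)
    (hsum : Summable fun n => ‖f n‖ * ‖weightedIncrement 𝕜 e W n‖) :
    ∃ T : X →L[𝕜] X, ∀ (p : 𝕜[X]) (n : ℕ),
      (T ^ n) (weightedMap e W p) = weightedMap e W (taylor (n : 𝕜) p) := by
  have hS : Summable fun n => (f n).smulRight (weightedIncrement 𝕜 e W n) :=
    Summable.of_norm (by simpa only [ContinuousLinearMap.norm_smulRight_apply] using hsum)
  set T : X →L[𝕜] X := 1 + ∑' n, (f n).smulRight (weightedIncrement 𝕜 e W n) with hT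
  have hTe : ∀ n, T (e n) = e n + weightedIncrement 𝕜 e W n := by
    intro n
    have h1 := hS.hasSum.mapL (ContinuousLinearMap.apply 𝕜 X (e n))
    have h2 : ∀ k, ContinuousLinearMap.apply 𝕜 X (e n)
        ((f k).smulRight (weightedIncrement 𝕜 e W k)) =
        if k = n then weightedIncrement 𝕜 e W n else 0 := by
      intro k
      simp only [ContinuousLinearMap.apply_apply, ContinuousLinearMap.smulRight_apply, hfe]
      split_ifs with hk
      · rw [hk, one_smul]
      · rw [zero_smul]
    simp only [h2] at h1
    have h3 := h1.unique (hasSum_ite_eq n _)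
    rw [hT, add_apply]
    exact congrArg (e n + ·) h3
  have hT1 : ∀ p : 𝕜[X], T (weightedMap e W p) = weightedMap e W (taylor 1 p) := by
    intro p
    induction p using Polynomial.induction_on' with
    | add p q hp hq => simp only [map_add, hp, hq]
    | monomial n c =>
      have hg : monomial n c = (c * ((n ! / W n : ℝ) : 𝕜)) • weightedMonomial 𝕜 W n := by
        have h1 := (hW n).ne'
        have h2 : (n ! : ℝ) ≠ 0 := by exact_mod_cast n.factorial_ne_zero
        rw [weightedMonomial, smul_monomial, smul_eq_mul, mul_assoc, ← RCLike.ofReal_mul,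
          div_mul_div_cancel₀ h1, div_self h2, RCLike.ofReal_one, mul_one]
      rw [hg, map_smul, map_smul, map_smul, map_smul, weightedMap_weightedMonomial hW, hTe,
        weightedIncrement, map_sub, weightedMap_weightedMonomial hW, add_sub_cancel]
  refine ⟨T, fun p n => ?_⟩
  induction n with
  | zero => simp
  | succ n ih =>
    rw [pow_succ', mul_apply_eq_comp, ih, hT1, taylor_taylor, Nat.cast_succ, add_comm]

theorem dense_range_weightedMap (hW : ∀ k, 0 < W k)
    (hd : Dense (Submodule.span 𝕜 (Set.range e) : Set X)) :
    Dense (Set.range (weightedMap e W : 𝕜[X] →ₗ[𝕜] X)) := by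
  rw [← LinearMap.coe_range]
  refine hd.mono (Submodule.span_le.2 ?_)
  rintro _ ⟨n, rfl⟩
  exact ⟨_, weightedMap_weightedMonomial hW n⟩

theorem exists_isStage_sequence {P : ℕ → Prop} (hP : ∀ n, ∃ b ≥ n, P b) :
    ∃ β : ℕ → ℕ, StrictMono β ∧ (∀ j, P (β j)) ∧ ∀ j, IsStage (β j) (β (j + 1)) := by
  have hnext : ∀ a, ∃ b, IsStage a b ∧ P b := by
    intro a
    obtain ⟨N, hN⟩ := eventually_atTop.1 (eventually_isStage a)
    obtain ⟨b, hb, hPb⟩ := hP N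
    exact ⟨b, hN b hb, hPb⟩
  choose next hstage hnextP using hnext
  obtain ⟨b₀, -, hb₀⟩ := hP 0
  let β : ℕ → ℕ := fun j => Nat.rec b₀ (fun _ b => next b) j
  refine ⟨β, strictMono_nat_of_lt_succ fun j => (hstage (β j)).1, fun j => ?_,
    fun j => hstage (β j)⟩
  cases j with
  | zero => exact hb₀
  | succ j => exact hnextP (β j)

/-- The product of the weights `(c i + 1)⁻⁴` for `1 ≤ i ≤ n`. -/
noncomputable def weightProd (c : ℕ → ℕ) (n : ℕ) : ℝ :=
  ∏ i ∈ Finset.range n, (((c (i + 1) : ℝ) + 1) ^ 4)⁻¹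

theorem weightProd_pos (c : ℕ → ℕ) (n : ℕ) : 0 < weightProd c n :=
  Finset.prod_pos fun _ _ => by positivity

theorem weightProd_succ (c : ℕ → ℕ) (n : ℕ) :
    weightProd c (n + 1) = weightProd c n * (((c (n + 1) : ℝ) + 1) ^ 4)⁻¹ :=
  Finset.prod_range_succ _ _

theorem weightProd_succ_le (c : ℕ → ℕ) (n : ℕ) : weightProd c (n + 1) ≤ weightProd c n := by
  rw [weightProd_succ]
  refine mul_le_of_le_one_right (weightProd_pos c n).le (inv_le_one_of_one_le₀ ?_)
  exact one_le_pow₀ (by linarith [(c (n + 1)).cast_nonneg (α := ℝ)])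

theorem weightProd_le_mul (c : ℕ → ℕ) {k n : ℕ} (hk : k < n) :
    weightProd c n ≤ (((c n : ℝ) + 1) ^ 4)⁻¹ * weightProd c k := by
  obtain ⟨m, rfl⟩ : ∃ m, n = m + 1 := ⟨n - 1, by omega⟩
  rw [weightProd_succ, mul_comm]
  gcongr
  exact antitone_nat_of_succ_le (weightProd_succ_le c) (Nat.lt_succ_iff.1 hk)

theorem inv_weightProd_le {c : ℕ → ℕ} {a b : ℕ} (ha : ∀ k ≤ a, c k ≤ a) (hb : ∀ k ≤ b, c k ≤ b)
    {k : ℕ} (hk : k ≤ b) :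
    (weightProd c k)⁻¹ ≤ ((a : ℝ) + 1) ^ (4 * min k a) * ((b : ℝ) + 1) ^ (4 * k) := by
  induction k with
  | zero => simp [weightProd]
  | succ k ih =>
    rw [weightProd_succ, mul_inv, inv_inv]
    have hcb : (c (k + 1) : ℝ) ≤ b := by exact_mod_cast hb _ hk
    rcases lt_or_ge k a with hka | hka
    · have hca : (c (k + 1) : ℝ) ≤ a := by exact_mod_cast ha _ hka
      have ih' := ih (by omega)
      rw [min_eq_left hka.le] at ih'
      rw [min_eq_left (Nat.succ_le_of_lt hka)]
      calc _ ≤ ((a : ℝ) + 1) ^ (4 * k) * ((b : ℝ) + 1) ^ (4 * k) * ((a : ℝ) + 1) ^ 4 := by gcongr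
        _ = ((a : ℝ) + 1) ^ (4 * (k + 1)) * ((b : ℝ) + 1) ^ (4 * k) := by ring
        _ ≤ _ := by
            gcongr
            · linarith [b.cast_nonneg (α := ℝ)]
            · omega
    · have ih' := ih (by omega)
      rw [min_eq_right hka] at ih'
      rw [min_eq_right (hka.trans k.le_succ)]
      calc _ ≤ ((a : ℝ) + 1) ^ (4 * a) * ((b : ℝ) + 1) ^ (4 * k) * ((b : ℝ) + 1) ^ 4 := by gcongr
        _ = _ := by ring

theorem factorial_div_weightProd_le {c : ℕ → ℕ} {a b : ℕ} (ha : ∀ k ≤ a, c k ≤ a)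
    (hb : ∀ k ≤ b, c k ≤ b) {k : ℕ} (hk : k ≤ b) :
    k ! / weightProd c k ≤ (weightConst a : ℝ) * (scale b : ℝ) ^ k := by
  have h1 := inv_weightProd_le ha hb hk
  have h2 : (k ! : ℝ) ≤ ((b : ℝ) + 1) ^ k := by
    have h3 : (k ! : ℝ) ≤ (k : ℝ) ^ k := by exact_mod_cast k.factorial_le_pow
    have h4 : (k : ℝ) ≤ b := by exact_mod_cast hk
    exact h3.trans (pow_le_pow_left₀ k.cast_nonneg (by linarith) k)
  have ha0 : (0 : ℝ) ≤ a := a.cast_nonneg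
  calc k ! / weightProd c k = k ! * (weightProd c k)⁻¹ := div_eq_mul_inv _ _
    _ ≤ ((b : ℝ) + 1) ^ k * (((a : ℝ) + 1) ^ (4 * a) * ((b : ℝ) + 1) ^ (4 * k)) := by
        have := weightProd_pos c k
        refine mul_le_mul h2 (h1.trans ?_) (by positivity) (by positivity)
        gcongr
        · linarith
        · exact min_le_right _ _
    _ = _ := by
        rw [weightConst, scale]
        push_cast
        rw [← pow_mul]
        ring

/-- The operators to which the Baire category arguments are applied: they extend the translation
operator on polynomials, for an embedding of the polynomials with controlled norm. -/
theorem exists_translation_operator [CompleteSpace X] [TopologicalSpace.SeparableSpace X]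
    (hX : ¬ FiniteDimensional 𝕜 X) :
    ∃ (T : X →L[𝕜] X) (Φ : 𝕜[X] →ₗ[𝕜] X) (β : ℕ → ℕ), StrictMono β ∧
      (∀ j, IsStage (β j) (β (j + 1))) ∧ Dense (Set.range Φ) ∧
      (∀ (p : 𝕜[X]) (n : ℕ), (T ^ n) (Φ p) = Φ (taylor (n : 𝕜) p)) ∧
      (∀ j (p : 𝕜[X]), p.natDegree ≤ β (j + 1) →
        ‖Φ p‖ ≤ weightConst (β j) * polyNorm (scale (β (j + 1))) p) ∧ Φ 1 ≠ 0 := by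
  obtain ⟨e, f, he, hfe, hdense, hgood⟩ := exists_biorthogonal_sequence (𝕜 := 𝕜) hX
  obtain ⟨β, hβ, hβf, hstage⟩ := exists_isStage_sequence hgood
  have hex : ∀ k, ∃ j, k ≤ β j := fun k => ⟨k, hβ.le_apply⟩
  let c : ℕ → ℕ := fun k => β (Nat.find (hex k))
  have hkc : ∀ k, k ≤ c k := fun k => Nat.find_spec (hex k)
  have hcβ : ∀ j, ∀ k ≤ β j, c k ≤ β j := fun j k hk =>
    hβ.monotone (Nat.find_min' (hex k) hk)
  have hfc : ∀ k, ‖f k‖ ≤ (c k : ℝ) + 1 := fun k => hβf _ k (hkc k)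
  have hW := weightProd_pos c
  have hsum : Summable fun n => ‖f n‖ * ‖weightedIncrement 𝕜 e (weightProd c) n‖ := by
    refine Summable.of_nonneg_of_le (fun n => by positivity) (fun n => ?_)
      ((summable_nat_add_iff 1).2 (Real.summable_nat_pow_inv.2 one_lt_two))
    have h1 := norm_weightedIncrement_le (𝕜 := 𝕜) he hW (n := n)
      fun k hk => weightProd_le_mul c hk
    have h2 : (n : ℝ) ≤ c n := by exact_mod_cast hkc n
    have h3 : (0 : ℝ) ≤ n := n.cast_nonneg
    calc _ ≤ ((c n : ℝ) + 1) * (((c n : ℝ) + 1) * (((c n : ℝ) + 1) ^ 4)⁻¹) := by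
          refine mul_le_mul (hfc n) (h1.trans ?_) (norm_nonneg _) (by positivity)
          gcongr
          linarith
      _ = (((c n : ℝ) + 1) ^ 2)⁻¹ := by
          field_simp
      _ ≤ (((n + 1 : ℕ) : ℝ) ^ 2)⁻¹ := by
          push_cast
          gcongr
  obtain ⟨T, hT⟩ := exists_operator_weightedMap hfe hW hsum
  refine ⟨T, weightedMap e (weightProd c), β, hβ, hstage, dense_range_weightedMap hW hdense, hT,
    fun j p hp => norm_weightedMap_le he hW
      (fun k hk => factorial_div_weightProd_le (hcβ j) (hcβ (j + 1)) hk) hp, fun h0 => ?_⟩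
  have h1 : weightedMap e (weightProd c) (1 : 𝕜[X]) = e 0 := by
    rw [← monomial_zero_one, weightedMap_monomial]
    simp [weightProd]
  have h2 := hfe 0 0
  rw [← h1, h0, map_zero] at h2
  simp at h2

end WeightedMap

section Transitivity

open Polynomial

variable {𝕜 : Type*} [RCLike 𝕜] {X : Type*} [NormedAddCommGroup X] [NormedSpace 𝕜 X]
  {T : X →L[𝕜] X} {Φ : 𝕜[X] →ₗ[𝕜] X} {β : ℕ → ℕ}

theorem eventually_polyNorm_le (hβ : StrictMono β) (p : 𝕜[X]) :
    ∀ᶠ j in atTop, p.natDegree ≤ β j ∧ polyNorm 1 p ≤ β j := by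
  refine (hβ.tendsto_atTop.eventually_ge_atTop p.natDegree).and ?_
  exact (tendsto_natCast_atTop_atTop.comp hβ.tendsto_atTop).eventually_ge_atTop _

theorem eventually_one_div_lt (hβ : StrictMono β) {ε : ℝ} (hε : 0 < ε) :
    ∀ᶠ j in atTop, 1 / ((β j : ℝ) + 1) < ε :=
  (tendsto_one_div_add_atTop_nhds_zero_nat.comp hβ.tendsto_atTop).eventually_lt_const hε

theorem exists_transitive_of_translation (hβ : StrictMono β)
    (hstage : ∀ j, IsStage (β j) (β (j + 1)))
    (hT : ∀ (p : 𝕜[X]) (n : ℕ), (T ^ n) (Φ p) = Φ (taylor (n : 𝕜) p))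
    (hΦ : ∀ j (p : 𝕜[X]), p.natDegree ≤ β (j + 1) →
      ‖Φ p‖ ≤ weightConst (β j) * polyNorm (scale (β (j + 1))) p)
    (p q : 𝕜[X]) {ε : ℝ} (hε : 0 < ε) :
    ∃ v : X, ∃ n : ℕ, ‖v - Φ p‖ < ε ∧ ‖(T ^ n) v - Φ q‖ < ε := by
  obtain ⟨j, ⟨hp, hp1⟩, ⟨hq, hq1⟩, hj⟩ := ((eventually_polyNorm_le hβ p).and
    ((eventually_polyNorm_le hβ q).and (eventually_one_div_lt hβ (half_pos hε)))).exists
  have hlt := (hstage j).1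
  have hpb := natDegree_damp_le (𝕜 := 𝕜) hlt.le hp
  obtain ⟨v, hv, hv1, hv2⟩ := (hstage j).exists_taylor_sub_le hq hq1
  refine ⟨Φ (damp (β j) (β (j + 1)) p + v), stageTime (β j) (β (j + 1)), ?_, ?_⟩
  · rw [← map_sub, add_sub_right_comm, map_add]
    have h1 := (hΦ j (damp (β j) (β (j + 1)) p - p)
      (natDegree_sub_le_of_le hpb (hp.trans hlt.le) |>.trans (max_self _).le)).trans
      ((hstage j).polyNorm_damp_sub_le hp hp1)
    have h2 := (hΦ j v hv).trans hv1
    have h3 := norm_add_le (Φ (damp (β j) (β (j + 1)) p - p)) (Φ v)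
    linarith
  · rw [hT, ← map_sub, map_add, add_sub_assoc, map_add]
    have h1 := (hΦ j (taylor (stageTime (β j) (β (j + 1)) : 𝕜) (damp (β j) (β (j + 1)) p))
      (by rwa [natDegree_taylor])).trans
      ((hstage j).polyNorm_taylor_damp_le hp hp1 le_rfl
        (Nat.le_mul_of_pos_left _ (Nat.succ_pos _)))
    have h2 := (hΦ j (taylor (stageTime (β j) (β (j + 1)) : 𝕜) v - q)
      (natDegree_sub_le_of_le (by rwa [natDegree_taylor]) (hq.trans hlt.le) |>.trans
        (max_self _).le)).trans hv2
    have h3 := norm_add_le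
      (Φ (taylor (stageTime (β j) (β (j + 1)) : 𝕜) (damp (β j) (β (j + 1)) p)))
      (Φ (taylor (stageTime (β j) (β (j + 1)) : 𝕜) v - q))
    linarith

theorem eventually_damp_small (hβ : StrictMono β) (hstage : ∀ j, IsStage (β j) (β (j + 1)))
    (hT : ∀ (p : 𝕜[X]) (n : ℕ), (T ^ n) (Φ p) = Φ (taylor (n : 𝕜) p))
    (hΦ : ∀ j (p : 𝕜[X]), p.natDegree ≤ β (j + 1) →
      ‖Φ p‖ ≤ weightConst (β j) * polyNorm (scale (β (j + 1))) p)
    (p : 𝕜[X]) {ε : ℝ} (hε : 0 < ε) :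
    ∀ᶠ j in atTop, ‖Φ (damp (β j) (β (j + 1)) p) - Φ p‖ < ε ∧
      ∀ n ≤ stageTime (β j) (β (j + 1)), stageTime (β j) (β (j + 1)) ≤ (j + 1) * n →
        ‖(T ^ n) (Φ (damp (β j) (β (j + 1)) p))‖ < ε := by
  filter_upwards [eventually_polyNorm_le hβ p, eventually_one_div_lt hβ hε] with j hpj hj
  obtain ⟨hp, hp1⟩ := hpj
  have hlt := (hstage j).1
  have hpb := natDegree_damp_le (𝕜 := 𝕜) hlt.le hp
  refine ⟨?_, fun n hn hn' => ?_⟩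
  · rw [← map_sub]
    exact ((hΦ j _ (natDegree_sub_le_of_le hpb (hp.trans hlt.le) |>.trans (max_self _).le)).trans
      ((hstage j).polyNorm_damp_sub_le hp hp1)).trans_lt hj
  · rw [hT]
    refine ((hΦ j _ (by rwa [natDegree_taylor])).trans
      ((hstage j).polyNorm_taylor_damp_le hp hp1 hn (hn'.trans ?_))).trans_lt hj
    gcongr
    exact hβ.le_apply

theorem tendsto_norm_pow_translation
    (hT : ∀ (p : 𝕜[X]) (n : ℕ), (T ^ n) (Φ p) = Φ (taylor (n : 𝕜) p)) (h1 : Φ 1 ≠ 0) :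
    Tendsto (fun n : ℕ => ‖(T ^ n) (Φ Polynomial.X)‖) atTop atTop := by
  have hlim : Tendsto (fun n : ℕ => (n : ℝ) * ‖Φ 1‖ + -‖Φ Polynomial.X‖) atTop atTop :=
    tendsto_atTop_add_const_right _ _
      (tendsto_natCast_atTop_atTop.atTop_mul_const (norm_pos_iff.2 h1))
  refine tendsto_atTop_mono (fun n => ?_) hlim
  have hX : (T ^ n) (Φ Polynomial.X) = (n : 𝕜) • Φ 1 + Φ Polynomial.X := by
    rw [hT, taylor_X, map_add, add_comm, ← map_smul, smul_eq_C_mul, mul_one]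
  rw [hX]
  have h2 := norm_sub_norm_le ((n : 𝕜) • Φ 1) (-Φ Polynomial.X)
  rw [norm_smul, RCLike.norm_natCast, norm_neg, sub_neg_eq_add] at h2
  linarith

end Transitivity

/-- Every infinite-dimensional separable Banach space supports a hypercyclic,
distributionally chaotic operator admitting a dense distributionally irregular manifold. -/
theorem exists_hypercyclic_distChaotic_operator
    {𝕜 : Type*} [RCLike 𝕜] {X : Type*} [NormedAddCommGroup X] [NormedSpace 𝕜 X]
    [CompleteSpace X] [TopologicalSpace.SeparableSpace X]
    (h : ¬ FiniteDimensional 𝕜 X) :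
    ∃ T : X →L[𝕜] X,
      (∃ x : X, Dense (Set.range (fun n : ℕ => (T ^ n) x))) ∧
      DistChaotic T ∧ DenseDistIrregularManifold T := by
  obtain ⟨T, Φ, β, hβ, hstage, hdense, hT, hΦ, h1⟩ := exists_translation_operator h
  refine ⟨T, exists_dense_orbit_of_transitive hdense ?_, ?_⟩
  · rintro _ ⟨p, rfl⟩ _ ⟨q, rfl⟩ ε hε
    exact exists_transitive_of_translation hβ hstage hT hΦ p q hε
  have hN : Tendsto (fun j => stageTime (β j) (β (j + 1))) atTop atTop := by
    refine tendsto_atTop_mono (fun j => ?_) tendsto_id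
    have h2 := (le_scale (β (j + 1))).trans (scale_le_stageTime (β j) (β (j + 1)))
    have h3 : β (j + 1) + 1 ≤ stageTime (β j) (β (j + 1)) := by exact_mod_cast h2
    have h4 : j + 1 ≤ β (j + 1) := hβ.le_apply
    exact (show j ≤ β (j + 1) + 1 by omega).trans h3
  obtain ⟨Y, hYd, hY⟩ := exists_dense_submodule_intervalIrregular hdense hN
    (y := fun j x => Φ (damp (β j) (β (j + 1)) (Function.invFun Φ x)))
    (fun x hx ε hε => by
      have h2 := eventually_damp_small hβ hstage hT hΦ (Function.invFun Φ x) hε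
      rwa [Function.invFun_eq hx] at h2)
    (tendsto_norm_pow_translation hT h1)
  have : Nontrivial X := ⟨⟨_, _, h1⟩⟩
  obtain ⟨y, hyY, hy0⟩ : ∃ y ∈ Y, y ≠ 0 := by
    by_contra! hall
    have hbot : Y = ⊥ := (Submodule.eq_bot_iff Y).2 hall
    obtain ⟨y, hy⟩ := exists_ne (0 : X)
    have h2 := hYd.closure_eq
    rw [hbot, Submodule.bot_coe, closure_singleton] at h2
    exact hy (Set.mem_singleton_iff.1 (h2.ge (Set.mem_univ y)))
  refine ⟨distChaotic_of_intervalIrregular hy0 fun c hc =>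
    hY _ (Y.smul_mem c hyY) (smul_ne_zero hc hy0), Y, hYd, fun y hyY hy0 =>
    (hY y hyY hy0).distIrregularVector⟩
end
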